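/- arXiv:0906.2685 — 5 statements merged into one kernel-verified Lean document; each statement's English description precedes it below -/
import Mathlib

section
/- Let 0 < λ < μ. Then: (1) the restriction of ā_λ to D(A) coincides with a, i.e., ā_λ(u) = −⟨Ψ, (A+B)u⟩ for every u ∈ D(A); and (2) ā_λ = ā_μ as functionals on D(G). Consequently a single functional ā := ā_λ on D(G) is well defined, independent of λ > 0. -/
open Filter Topology Set MeasureTheory

noncomputable section

variable {X : Type*} [NormedAddCommGroup X] [NormedSpace ℝ X] [CompleteSpace X] [PartialOrder X]

/-- A `C₀`-semigroup on `X` (strong continuity required on `[0,∞)`). -/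
structure IsC0Semigroup (T : ℝ → X →L[ℝ] X) : Prop where
  map_zero : T 0 = ContinuousLinearMap.id ℝ X
  map_add : ∀ s t : ℝ, 0 ≤ s → 0 ≤ t → T (s + t) = (T s).comp (T t)
  strongCont : ∀ u : X, ContinuousOn (fun t => T t u) (Ici (0 : ℝ))

/-- A substochastic `C₀`-semigroup: positive and contracting on the positive cone. -/
def IsSubstochastic (T : ℝ → X →L[ℝ] X) : Prop :=
  IsC0Semigroup T ∧ ∀ t : ℝ, 0 ≤ t → ∀ u : X, 0 ≤ u → 0 ≤ T t u ∧ ‖T t u‖ ≤ ‖u‖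

/-- `G` is the infinitesimal generator of the semigroup `T`. -/
def IsGeneratorOf (G : X →ₗ.[ℝ] X) (T : ℝ → X →L[ℝ] X) : Prop :=
  (∀ u : X, u ∈ G.domain ↔
    ∃ v : X, Tendsto (fun t : ℝ => t⁻¹ • (T t u - u)) (𝓝[>] 0) (𝓝 v)) ∧
  ∀ u : G.domain, Tendsto (fun t : ℝ => t⁻¹ • (T t (u : X) - (u : X))) (𝓝[>] 0) (𝓝 (G u))

/-- The bounded operator `B(λ - A)⁻¹`, given the resolvent `R = (λ - A)⁻¹` of `A`. -/
def Jfun (A : X →ₗ.[ℝ] X) (B : A.domain →ₗ[ℝ] X) (R : X →L[ℝ] X)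
    (hdom : ∀ u : X, R u ∈ A.domain) : X → X :=
  fun u => B ⟨R u, hdom u⟩

/-- The functional `a(u) = -⟨Ψ, (A+B)u⟩` on `D(A)`. -/
def aFun (Ψ : X →L[ℝ] ℝ) (A : X →ₗ.[ℝ] X) (B : A.domain →ₗ[ℝ] X) (w : A.domain) : ℝ :=
  -Ψ (A w + B w)

/-- The value `ā((λ-G)⁻¹u) = Σₙ a((λ-A)⁻¹[B(λ-A)⁻¹]ⁿ u)`, expressed through the
resolvent `R = (λ-A)⁻¹` of `A`. -/
def abarRes (Ψ : X →L[ℝ] ℝ) (A : X →ₗ.[ℝ] X) (B : A.domain →ₗ[ℝ] X)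
    (R : X →L[ℝ] X) (hdom : ∀ u : X, R u ∈ A.domain) (u : X) : ℝ :=
  ∑' n : ℕ, aFun Ψ A B ⟨R ((Jfun A B R hdom)^[n] u), hdom _⟩

/-- `⟨Ξ_λ, u⟩ = a₀((λ-G)⁻¹u) - ā((λ-G)⁻¹u)`, where `RA = (λ-A)⁻¹`, `RG = (λ-G)⁻¹` and
`a₀(v) = -⟨Ψ, G v⟩`. -/
def xiRes (Ψ : X →L[ℝ] ℝ) (A : X →ₗ.[ℝ] X) (B : A.domain →ₗ[ℝ] X) (G : X →ₗ.[ℝ] X)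
    (RA RG : X →L[ℝ] X) (hAdom : ∀ u : X, RA u ∈ A.domain)
    (hGdom : ∀ u : X, RG u ∈ G.domain) (u : X) : ℝ :=
  (-(Ψ (G ⟨RG u, hGdom u⟩))) - abarRes Ψ A B RA hAdom u

/-- The functional `ā` on `D(G)`: `ā(v) = ā((λ-G)⁻¹ u)` for `u = λ v - G v`
(written through the resolvent `R = (λ-A)⁻¹`). -/
def abarOn (Ψ : X →L[ℝ] ℝ) (A : X →ₗ.[ℝ] X) (B : A.domain →ₗ[ℝ] X) (G : X →ₗ.[ℝ] X)
    (R : X →L[ℝ] X) (hdom : ∀ u : X, R u ∈ A.domain) (l : ℝ) (v : G.domain) : ℝ :=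
  abarRes Ψ A B R hdom (l • (v : X) - G v)

/-- `v` belongs to the domain of the closure of `(A + B, D(A))` (together with a limit of
the corresponding values). -/
def InClosureDomain (A : X →ₗ.[ℝ] X) (B : A.domain →ₗ[ℝ] X) (v : X) : Prop :=
  ∃ (f : ℕ → A.domain) (w : X),
    Tendsto (fun n => ((f n : X))) atTop (𝓝 v) ∧
    Tendsto (fun n => A (f n) + B (f n)) atTop (𝓝 w)

section helpers

variable {Y : Type*} [NormedAddCommGroup Y] [NormedSpace ℝ Y]

lemma hp_pow (R1 J1 J2 : Y →L[ℝ] Y) (κ : ℝ)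
    (hJ : ∀ x, J1 x = J2 x + κ • J2 (R1 x)) (u : Y) (n : ℕ) :
    (J1 ^ n) u = (J2 ^ n) u
      + κ • ∑ i ∈ Finset.range n, (J2 ^ (i + 1)) (R1 ((J1 ^ (n - 1 - i)) u)) := by
  induction n with
  | zero => simp
  | succ n ih =>
    have h1 : (J1 ^ (n + 1)) u = J1 ((J1 ^ n) u) := by rw [pow_succ']; rfl
    have h2 : ∀ k x, (J2 ^ (k + 1)) x = J2 ((J2 ^ k) x) := by
      intro k x; rw [pow_succ']; rfl
    rw [h1, hJ, Finset.sum_range_succ']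
    conv_lhs => arg 1; rw [ih]
    rw [h2 n u, map_add, map_smul, map_sum, smul_add, add_assoc]
    have e : ∑ i ∈ Finset.range n, J2 ((J2 ^ (i + 1)) (R1 ((J1 ^ (n - 1 - i)) u)))
        = ∑ i ∈ Finset.range n, (J2 ^ (i + 1 + 1)) (R1 ((J1 ^ (n + 1 - 1 - (i + 1))) u)) := by
      apply Finset.sum_congr rfl
      intro i hi
      rw [h2 (i + 1), show n + 1 - 1 - (i + 1) = n - 1 - i by omega]
    rw [e]
    simp

lemma hp_coef (R1 J1 J2 : Y →L[ℝ] Y) (a1 a2 : Y →L[ℝ] ℝ) (κ : ℝ)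
    (hJ : ∀ x, J1 x = J2 x + κ • J2 (R1 x))
    (ha : ∀ x, a1 x = a2 x + κ * a2 (R1 x)) (u : Y) (n : ℕ) :
    a1 ((J1 ^ n) u) = a2 ((J2 ^ n) u)
      + κ * ∑ i ∈ Finset.range (n + 1), a2 ((J2 ^ i) (R1 ((J1 ^ (n - i)) u))) := by
  rw [ha, Finset.sum_range_succ']
  conv_lhs => arg 1; rw [hp_pow R1 J1 J2 κ hJ u n]
  rw [map_add, map_smul, map_sum, smul_eq_mul, mul_add, add_assoc]
  have e : ∑ i ∈ Finset.range n, a2 ((J2 ^ (i + 1)) (R1 ((J1 ^ (n - 1 - i)) u)))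
      = ∑ i ∈ Finset.range n, a2 ((J2 ^ (i + 1)) (R1 ((J1 ^ (n - (i + 1))) u))) := by
    apply Finset.sum_congr rfl
    intro i hi
    rw [show n - (i + 1) = n - 1 - i by omega]
  rw [e]
  simp

lemma hp_conv (h : ℕ → Y →L[ℝ] ℝ) (w : ℕ → Y) (M : ℕ) :
    ∑ N ∈ Finset.range (M + 1), ∑ n ∈ Finset.range (N + 1),
        ∑ i ∈ Finset.range (n + 1), h i (w (n - i))
      = ∑ m ∈ Finset.range (M + 1), (∑ i ∈ Finset.range (m + 1), h i)
          (∑ j ∈ Finset.range (M - m + 1), w j) := by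
  have key : ∀ N, ∑ n ∈ Finset.range (N + 1), ∑ i ∈ Finset.range (n + 1), h i (w (n - i))
      = ∑ m ∈ Finset.range (N + 1), (∑ i ∈ Finset.range (m + 1), h i) (w (N - m)) := by
    intro N
    induction N with
    | zero => simp
    | succ N ih =>
      rw [Finset.sum_range_succ, ih]
      have : ∑ m ∈ Finset.range (N + 1 + 1), (∑ i ∈ Finset.range (m + 1), h i) (w (N + 1 - m))
          = ∑ m ∈ Finset.range (N + 1 + 1), (∑ i ∈ Finset.range m, h i) (w (N + 1 - m))
           + ∑ m ∈ Finset.range (N + 1 + 1), h m (w (N + 1 - m)) := by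
        rw [← Finset.sum_add_distrib]
        apply Finset.sum_congr rfl
        intro m _
        rw [Finset.sum_range_succ]; rfl
      rw [this]
      congr 1
      rw [Finset.sum_range_succ' _ (N + 1)]
      simp
  induction M with
  | zero => simp
  | succ M ih =>
    rw [Finset.sum_range_succ, ih, key (M + 1)]
    rw [Finset.sum_range_succ (fun m => (∑ i ∈ Finset.range (m + 1), h i) (w (M + 1 - m))) (M + 1),
      Finset.sum_range_succ (fun m => (∑ i ∈ Finset.range (m + 1), h i)
        (∑ j ∈ Finset.range (M + 1 - m + 1), w j)) (M + 1), ← add_assoc,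
      ← Finset.sum_add_distrib]
    congr 1
    · apply Finset.sum_congr rfl
      intro m hm
      have hm' := Finset.mem_range.1 hm
      rw [show M + 1 - m = M - m + 1 by omega, Finset.sum_range_succ _ (M - m + 1), map_add]
    · simp

lemma hp_cauchy [CompleteSpace Y] (h : ℕ → Y →L[ℝ] ℝ) (hh : ∀ x, Summable (fun n => h n x))
    (w : ℕ → Y) (v : Y)
    (hw : Tendsto (fun n => ∑ j ∈ Finset.range (n + 1), w j) atTop (𝓝 v))
    (hc : Summable (fun n => ∑ i ∈ Finset.range (n + 1), h i (w (n - i)))) :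
    ∑' n, ∑ i ∈ Finset.range (n + 1), h i (w (n - i)) = ∑' n, h n v := by
  set H : ℕ → Y →L[ℝ] ℝ := fun m => ∑ i ∈ Finset.range (m + 1), h i with hH
  set W : ℕ → Y := fun n => ∑ j ∈ Finset.range (n + 1), w j with hW
  have hHx : ∀ x, Tendsto (fun m => H m x) atTop (𝓝 (∑' n, h n x)) := by
    intro x
    have := (hh x).hasSum.tendsto_sum_nat.comp (tendsto_add_atTop_nat 1)
    refine this.congr fun m => ?_
    simp [hH]
  obtain ⟨K, hK⟩ : ∃ K, ∀ m, ‖H m‖ ≤ K := by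
    apply banach_steinhaus
    intro x
    obtain ⟨C, hC⟩ := (hHx x).norm.bddAbove_range
    exact ⟨C, fun i => hC ⟨i, rfl⟩⟩
  have hK0 : 0 ≤ K := (norm_nonneg _).trans (hK 0)
  have t1 := (hc.hasSum.tendsto_sum_nat.comp (tendsto_add_atTop_nat 1)).cesaro.comp
    (tendsto_add_atTop_nat 1)
  have t2 := (hHx v).cesaro.comp (tendsto_add_atTop_nat 1)
  have hd : Tendsto (fun n => ‖W n - v‖) atTop (𝓝 0) := by
    have := (hw.sub_const v).norm
    simpa using this
  have t3 := (hd.cesaro.comp (tendsto_add_atTop_nat 1)).const_mul K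
  rw [mul_zero] at t3
  have t4 := t1.sub t2
  have t5 : Tendsto (fun M : ℕ => ((M + 1 : ℕ) : ℝ)⁻¹ * ∑ m ∈ Finset.range (M + 1),
      H m (W (M - m) - v)) atTop (𝓝 0) := by
    refine squeeze_zero_norm (fun M => ?_) t3
    simp only [Function.comp]
    rw [norm_mul, Real.norm_of_nonneg (by positivity), ← mul_assoc, mul_comm K, mul_assoc]
    apply mul_le_mul_of_nonneg_left _ (by positivity)
    refine (norm_sum_le _ _).trans ?_
    rw [Finset.mul_sum, ← Finset.sum_range_reflect (fun i => K * ‖W i - v‖)]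
    apply Finset.sum_le_sum
    intro m hm
    rw [show M + 1 - 1 - m = M - m by omega]
    exact ((H m).le_opNorm _).trans (mul_le_mul_of_nonneg_right (hK m) (norm_nonneg _))
  have := tendsto_nhds_unique (t4.congr (fun M => ?_)) t5
  · exact sub_eq_zero.1 this
  · simp only [Function.comp]
    rw [hp_conv, ← mul_sub, ← Finset.sum_sub_distrib]
    simp only [map_sub]
    rfl

end helpers

/-- The functionals `ā_λ` agree with `a` on `D(A)` and are independent of `λ > 0`:
for `0 < λ < μ`, `ā_λ(u) = a(u)` for `u ∈ D(A)` and `ā_λ(v) = ā_μ(v)` for `v ∈ D(G)`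
(an element `v ∈ D(G)` is written as `v = (λ-G)⁻¹(λ v - G v)`, and `u ∈ D(A)` as
`u = (λ-G)⁻¹(λ u - (A+B)u)`). -/
theorem abar_restriction_and_independence
    (hconeadd : ∀ u v : X, 0 ≤ u → 0 ≤ v → 0 ≤ u + v)
    (hconesmul : ∀ (c : ℝ) (u : X), 0 ≤ c → 0 ≤ u → 0 ≤ c • u)
    (hgen : ∀ u : X, ∃ v w : X, 0 ≤ v ∧ 0 ≤ w ∧ u = v - w)
    (haddnorm : ∀ u v : X, 0 ≤ u → 0 ≤ v → ‖u + v‖ = ‖u‖ + ‖v‖)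
    (Ψ : X →L[ℝ] ℝ) (hΨ : ∀ u : X, 0 ≤ u → Ψ u = ‖u‖)
    (U : ℝ → X →L[ℝ] X) (hU : IsSubstochastic U)
    (A : X →ₗ.[ℝ] X) (hA : IsGeneratorOf A U)
    (B : A.domain →ₗ[ℝ] X)
    (hBpos : ∀ u : A.domain, 0 ≤ (u : X) → 0 ≤ B u)
    (hdiss : ∀ u : A.domain, 0 ≤ (u : X) → Ψ (A u + B u) ≤ 0)
    -- the resolvent of A for λ > 0
    (RA : ℝ → X →L[ℝ] X)
    (hRAdom : ∀ (l : ℝ) (u : X), RA l u ∈ A.domain)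
    (hRAeq : ∀ (l : ℝ), 0 < l → ∀ u : X, l • RA l u - A ⟨RA l u, hRAdom l u⟩ = u)
    (hRAinv : ∀ (l : ℝ), 0 < l → ∀ v : A.domain, RA l (l • (v : X) - A v) = (v : X))
    -- the minimal substochastic semigroup V generated by an extension G of A + B
    (G : X →ₗ.[ℝ] X) (V : ℝ → X →L[ℝ] X)
    (hV : IsSubstochastic V) (hGV : IsGeneratorOf G V)
    (hGext : ∀ u : A.domain, ∃ h : (u : X) ∈ G.domain, G ⟨(u : X), h⟩ = A u + B u)
    -- the resolvent of G for λ > 0 ...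
    (RG : ℝ → X →L[ℝ] X)
    (hRGdom : ∀ (l : ℝ) (u : X), RG l u ∈ G.domain)
    (hRGeq : ∀ (l : ℝ), 0 < l → ∀ u : X, l • RG l u - G ⟨RG l u, hRGdom l u⟩ = u)
    (hRGinv : ∀ (l : ℝ), 0 < l → ∀ v : G.domain, RG l (l • (v : X) - G v) = (v : X))
    -- ... given by the strongly convergent series (λ-G)⁻¹u = Σₙ (λ-A)⁻¹[B(λ-A)⁻¹]ⁿu
    (hseries : ∀ (l : ℝ), 0 < l → ∀ u : X,
      Tendsto (fun n : ℕ =>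
          ∑ k ∈ Finset.range (n + 1), RA l ((Jfun A B (RA l) (hRAdom l))^[k] u))
        atTop (𝓝 (RG l u)))
    -- the series defining ā converges
    (hsum : ∀ (l : ℝ), 0 < l → ∀ u : X,
      Summable (fun n : ℕ =>
        aFun Ψ A B ⟨RA l ((Jfun A B (RA l) (hRAdom l))^[n] u), hRAdom l _⟩))
    (l μ : ℝ) (hl : 0 < l) (hlμ : l < μ) :
    -- (1) the restriction of ā_λ to D(A) is a
    (∀ u : A.domain,
      abarRes Ψ A B (RA l) (hRAdom l) (l • (u : X) - (A u + B u)) = aFun Ψ A B u) ∧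
    -- (2) ā_λ = ā_μ on D(G)
    (∀ v : G.domain,
      abarRes Ψ A B (RA l) (hRAdom l) (l • (v : X) - G v) =
        abarRes Ψ A B (RA μ) (hRAdom μ) (μ • (v : X) - G v)) := by
  -- continuity of `B (l - A)⁻¹`
  have hJ : ∀ m : ℝ, 0 < m → ∃ J : X →L[ℝ] X, ∀ x, J x = B ⟨RA m x, hRAdom m x⟩ := by
    intro m hm
    let J0 : X →ₗ[ℝ] X :=
      B ∘ₗ (LinearMap.codRestrict A.domain (RA m : X →ₗ[ℝ] X) (hRAdom m))
    have hJ0 : ∀ x, J0 x = B ⟨RA m x, hRAdom m x⟩ := fun x => rfl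
    have hAR : ∀ x, A ⟨RA m x, hRAdom m x⟩ = m • RA m x - x := by
      intro x
      have := hRAeq m hm x
      rw [sub_eq_iff_eq_add] at this
      rw [this]; abel
    have hcl : ∀ x, RG m (x - J0 x) = RA m x := by
      intro x
      obtain ⟨h, hg⟩ := hGext ⟨RA m x, hRAdom m x⟩
      have := hRGinv m hm ⟨RA m x, h⟩
      rw [hg, hAR] at this
      refine Eq.trans ?_ this
      rw [hJ0]
      congr 1
      simp only
      abel
    have hinj : ∀ x, RG m x = 0 → x = 0 := by
      intro x hx
      have := hRGeq m hm x
      have h0 : (⟨RG m x, hRGdom m x⟩ : G.domain) = 0 := Subtype.ext hx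
      rw [h0, hx, LinearPMap.map_zero] at this
      simpa using this.symm
    have hcont : Continuous J0 := by
      apply LinearMap.continuous_of_seq_closed_graph
      intro s x y hs hy
      have e1 : Tendsto (fun n => RG m (s n - J0 (s n))) atTop (𝓝 (RG m (x - y))) :=
        ((RG m).continuous.tendsto _).comp (hs.sub hy)
      have e2 : Tendsto (fun n => RG m (s n - J0 (s n))) atTop (𝓝 (RA m x)) := by
        simp only [hcl]
        exact ((RA m).continuous.tendsto _).comp hs
      have e3 := tendsto_nhds_unique e1 e2
      rw [← hcl x, ← sub_eq_zero, ← map_sub] at e3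
      have e4 := hinj _ e3
      have : J0 x - y = 0 := by rw [← e4]; abel
      exact (sub_eq_zero.1 this).symm
    exact ⟨⟨J0, hcont⟩, hJ0⟩
  have hAR : ∀ m : ℝ, 0 < m → ∀ x, A ⟨RA m x, hRAdom m x⟩ = m • RA m x - x := by
    intro m hm x
    have := hRAeq m hm x
    rw [sub_eq_iff_eq_add] at this
    rw [this]; abel
  have hiter : ∀ (m : ℝ) (J : X →L[ℝ] X), (∀ x, J x = B ⟨RA m x, hRAdom m x⟩) →
      ∀ n x, (Jfun A B (RA m) (hRAdom m))^[n] x = (J ^ n) x := by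
    intro m J h n x
    have e : Jfun A B (RA m) (hRAdom m) = J := by
      funext y; rw [h]; rfl
    rw [e]
    induction n generalizing x with
    | zero => rfl
    | succ n ih => rw [Function.iterate_succ_apply, ih, pow_succ]; rfl
  have ha : ∀ m : ℝ, 0 < m → ∃ a : X →L[ℝ] ℝ, ∀ x, a x = aFun Ψ A B ⟨RA m x, hRAdom m x⟩ := by
    intro m hm
    obtain ⟨J, hJ⟩ := hJ m hm
    refine ⟨-(Ψ.comp (m • RA m - ContinuousLinearMap.id ℝ X + J)), fun x => ?_⟩
    simp [aFun, hAR m hm, hJ]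
  have hμ : 0 < μ := hl.trans hlμ
  obtain ⟨J1, hJ1⟩ := hJ l hl
  obtain ⟨J2, hJ2⟩ := hJ μ hμ
  obtain ⟨a1, ha1⟩ := ha l hl
  obtain ⟨a2, ha2⟩ := ha μ hμ
  have hsum1 : ∀ u, Summable (fun n => a1 ((J1 ^ n) u)) := by
    intro u
    refine (hsum l hl u).congr fun n => ?_
    simp only [ha1, hiter l J1 hJ1]
  have hsum2 : ∀ u, Summable (fun n => a2 ((J2 ^ n) u)) := by
    intro u
    refine (hsum μ hμ u).congr fun n => ?_
    simp only [ha2, hiter μ J2 hJ2]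
  have hab1 : ∀ u, abarRes Ψ A B (RA l) (hRAdom l) u = ∑' n, a1 ((J1 ^ n) u) := by
    intro u
    simp only [abarRes, ha1, hiter l J1 hJ1]
  have hab2 : ∀ u, abarRes Ψ A B (RA μ) (hRAdom μ) u = ∑' n, a2 ((J2 ^ n) u) := by
    intro u
    simp only [abarRes, ha2, hiter μ J2 hJ2]
  constructor
  · intro u
    rw [hab1]
    set x := l • (u : X) - A u with hx
    have hRx : RA l x = u := hRAinv l hl u
    have hsub : (⟨RA l x, hRAdom l x⟩ : A.domain) = u := Subtype.ext hRx
    have e1 : l • (u : X) - (A u + B u) = x - J1 x := by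
      rw [hJ1, hsub, hx]; abel
    have e2 : ∀ n, a1 ((J1 ^ n) (x - J1 x)) = a1 ((J1 ^ n) x) - a1 ((J1 ^ (n + 1)) x) := by
      intro n
      rw [map_sub, map_sub, pow_succ]; rfl
    rw [e1]
    simp only [e2]
    have hs := hsum1 x
    have hs' := (summable_nat_add_iff 1).2 hs
    rw [hs.tsum_sub hs', hs.tsum_eq_zero_add, add_sub_cancel_right]
    rw [ha1, ← hsub]
    rfl
  · intro v
    set u := l • (v : X) - G v with hu
    have hv : RG l u = v := hRGinv l hl v
    have hres : ∀ x, RA l x = RA μ (x + (μ - l) • RA l x) := by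
      intro x
      have := hRAinv μ hμ ⟨RA l x, hRAdom l x⟩
      rw [hAR l hl] at this
      refine this.symm.trans ?_
      congr 1
      simp only
      module
    have hsub : ∀ x, (⟨RA l x, hRAdom l x⟩ : A.domain)
        = ⟨RA μ (x + (μ - l) • RA l x), hRAdom μ _⟩ := fun x => Subtype.ext (hres x)
    have hJJ : ∀ x, J1 x = J2 x + (μ - l) • J2 (RA l x) := by
      intro x
      rw [hJ1, hsub, ← hJ2, map_add, map_smul]
    have haa : ∀ x, a1 x = a2 x + (μ - l) * a2 (RA l x) := by
      intro x
      rw [ha1, hsub, ← ha2, map_add, map_smul, smul_eq_mul]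
    have hcoef := hp_coef (RA l) J1 J2 a1 a2 (μ - l) hJJ haa u
    have hκ : μ - l ≠ 0 := (sub_pos.2 hlμ).ne'
    have hc : Summable (fun n => ∑ i ∈ Finset.range (n + 1),
        (a2.comp (J2 ^ i)) (RA l ((J1 ^ (n - i)) u))) := by
      refine (((hsum1 u).sub (hsum2 u)).mul_left (μ - l)⁻¹).congr fun n => ?_
      rw [hcoef n, add_sub_cancel_left, inv_mul_cancel_left₀ hκ]
      rfl
    have hw : Tendsto (fun n => ∑ j ∈ Finset.range (n + 1), RA l ((J1 ^ j) u)) atTop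
        (𝓝 (v : X)) := by
      have := hseries l hl u
      rw [hv] at this
      simpa only [hiter l J1 hJ1] using this
    have hfin := hp_cauchy (fun i => a2.comp (J2 ^ i)) hsum2 (fun j => RA l ((J1 ^ j) u)) v hw hc
    have e : μ • (v : X) - G v = u + (μ - l) • (v : X) := by
      rw [hu]; module
    rw [hab1, hab2, e]
    have e3 : ∀ n, a2 ((J2 ^ n) (u + (μ - l) • (v : X)))
        = a2 ((J2 ^ n) u) + (μ - l) * (a2.comp (J2 ^ n)) (v : X) := by
      intro n
      rw [map_add, map_smul, map_add, map_smul]; rfl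
    have hs2v : Summable (fun n => (a2.comp (J2 ^ n)) (v : X)) := hsum2 v
    have e4 : ∀ n, a1 ((J1 ^ n) u) = a2 ((J2 ^ n) u) + (μ - l) *
        ∑ i ∈ Finset.range (n + 1), (a2.comp (J2 ^ i)) (RA l ((J1 ^ (n - i)) u)) := hcoef
    simp only [e3]
    rw [tsum_congr e4, (hsum2 u).tsum_add (hc.mul_left _),
      (hsum2 u).tsum_add (hs2v.mul_left _), tsum_mul_left, tsum_mul_left, hfin]
end
end

section
/- For every λ > 0 and every u ∈ X, ⟨Ξ_λ, u⟩ = lim_{n→∞} ⟨Ψ, [B(λ−A)^{-1}]ⁿ u⟩ = lim_{r↗1} (1−r)⟨Ψ, B(λ−G_r)^{-1}u⟩, where G_r = A + rB with domain D(A) (which generates a substochastic C₀-semigroup for every 0 ≤ r < 1). -/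
open Filter Topology Set MeasureTheory

noncomputable section

variable {X : Type*} [NormedAddCommGroup X] [NormedSpace ℝ X] [CompleteSpace X] [PartialOrder X]

theorem abel_aux (c : ℕ → ℝ) (L : ℝ) (hc : Tendsto c atTop (𝓝 L)) :
    (∀ r : ℝ, 0 ≤ r → r < 1 → Summable (fun k => r ^ k * c k)) ∧
    Tendsto (fun r : ℝ => (1 - r) * ∑' k, r ^ k * c k) (𝓝[<] 1) (𝓝 L) := by
  have hs : ∀ r : ℝ, 0 ≤ r → r < 1 → Summable (fun k => r ^ k * c k) := by
    intro r h0 h1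
    obtain ⟨M, hM⟩ := (Metric.isBounded_range_of_tendsto c hc).exists_norm_le
    refine Summable.of_norm_bounded ((summable_geometric_of_lt_one h0 h1).mul_right M) fun k => ?_
    rw [norm_mul, norm_pow, Real.norm_of_nonneg h0]
    exact mul_le_mul_of_nonneg_left (hM _ ⟨k, rfl⟩) (pow_nonneg h0 k)
  refine ⟨hs, ?_⟩
  let f : ℕ → ℝ := fun n => c n - (if n = 0 then 0 else c (n - 1))
  have hf : Tendsto (fun n => ∑ i ∈ Finset.range n, f i) atTop (𝓝 L) := by
    rw [← tendsto_add_atTop_iff_nat 1]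
    refine hc.congr fun n => ?_
    induction n with
    | zero => simp [f]
    | succ k ih => rw [Finset.sum_range_succ, ← ih]; simp [f]
  have h := Real.tendsto_tsum_powerSeries_nhdsWithin_lt hf
  refine h.congr' ?_
  have h01 : ∀ᶠ r : ℝ in 𝓝[<] 1, r ∈ Ioo (0:ℝ) 1 := Ioo_mem_nhdsLT (by norm_num)
  filter_upwards [h01] with r hr
  have hS := hs r hr.1.le hr.2
  have h2 : HasSum (fun n => if n = 0 then 0 else r ^ n * c (n - 1)) (r * ∑' k, r ^ k * c k) := by
    rw [← hasSum_nat_add_iff' 1]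
    have := hS.hasSum.mul_left r
    have e1 : (fun k : ℕ => if k + 1 = 0 then (0:ℝ) else r ^ (k + 1) * c (k + 1 - 1))
        = fun k => r * (r ^ k * c k) := by
      funext k
      rw [if_neg (Nat.succ_ne_zero k), Nat.add_sub_cancel]
      ring
    have e2 : (r * ∑' k, r ^ k * c k - ∑ i ∈ Finset.range 1,
        if i = 0 then (0:ℝ) else r ^ i * c (i - 1)) = r * ∑' k, r ^ k * c k := by simp
    rw [e1, e2]
    exact this
  have h3 := hS.hasSum.sub h2
  have h4 : (fun n => f n * r ^ n) = fun n => r ^ n * c n - (if n = 0 then 0 else r ^ n * c (n - 1)) := by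
    funext n
    simp only [f]
    split_ifs <;> ring
  rw [h4, h3.tsum_eq]; ring

/-- `⟨Ξ_λ, u⟩ = limₙ ⟨Ψ, [B(λ-A)⁻¹]ⁿ u⟩ = lim_{r↗1} (1-r)⟨Ψ, B(λ-G_r)⁻¹ u⟩`, where
`G_r = A + r B` with domain `D(A)` (whose resolvent for `0 ≤ r < 1`, `λ > 0` is the
family `RGr`). -/
theorem xi_eq_limits
    (hconeadd : ∀ u v : X, 0 ≤ u → 0 ≤ v → 0 ≤ u + v)
    (hconesmul : ∀ (c : ℝ) (u : X), 0 ≤ c → 0 ≤ u → 0 ≤ c • u)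
    (hgen : ∀ u : X, ∃ v w : X, 0 ≤ v ∧ 0 ≤ w ∧ u = v - w)
    (haddnorm : ∀ u v : X, 0 ≤ u → 0 ≤ v → ‖u + v‖ = ‖u‖ + ‖v‖)
    (Ψ : X →L[ℝ] ℝ) (hΨ : ∀ u : X, 0 ≤ u → Ψ u = ‖u‖)
    (U : ℝ → X →L[ℝ] X) (hU : IsSubstochastic U)
    (A : X →ₗ.[ℝ] X) (hA : IsGeneratorOf A U)
    (B : A.domain →ₗ[ℝ] X)
    (hBpos : ∀ u : A.domain, 0 ≤ (u : X) → 0 ≤ B u)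
    (hdiss : ∀ u : A.domain, 0 ≤ (u : X) → Ψ (A u + B u) ≤ 0)
    -- the resolvent of A for λ > 0
    (RA : ℝ → X →L[ℝ] X)
    (hRAdom : ∀ (l : ℝ) (u : X), RA l u ∈ A.domain)
    (hRAeq : ∀ (l : ℝ), 0 < l → ∀ u : X, l • RA l u - A ⟨RA l u, hRAdom l u⟩ = u)
    (hRAinv : ∀ (l : ℝ), 0 < l → ∀ v : A.domain, RA l (l • (v : X) - A v) = (v : X))
    -- the minimal substochastic semigroup V generated by an extension G of A + B
    (G : X →ₗ.[ℝ] X) (V : ℝ → X →L[ℝ] X)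
    (hV : IsSubstochastic V) (hGV : IsGeneratorOf G V)
    (hGext : ∀ u : A.domain, ∃ h : (u : X) ∈ G.domain, G ⟨(u : X), h⟩ = A u + B u)
    -- the resolvent of G for λ > 0 ...
    (RG : ℝ → X →L[ℝ] X)
    (hRGdom : ∀ (l : ℝ) (u : X), RG l u ∈ G.domain)
    (hRGeq : ∀ (l : ℝ), 0 < l → ∀ u : X, l • RG l u - G ⟨RG l u, hRGdom l u⟩ = u)
    (hRGinv : ∀ (l : ℝ), 0 < l → ∀ v : G.domain, RG l (l • (v : X) - G v) = (v : X))
    -- ... given by the strongly convergent series (λ-G)⁻¹u = Σₙ (λ-A)⁻¹[B(λ-A)⁻¹]ⁿu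
    (hseries : ∀ (l : ℝ), 0 < l → ∀ u : X,
      Tendsto (fun n : ℕ =>
          ∑ k ∈ Finset.range (n + 1), RA l ((Jfun A B (RA l) (hRAdom l))^[k] u))
        atTop (𝓝 (RG l u)))
    -- the series defining ā converges
    (hsum : ∀ (l : ℝ), 0 < l → ∀ u : X,
      Summable (fun n : ℕ =>
        aFun Ψ A B ⟨RA l ((Jfun A B (RA l) (hRAdom l))^[n] u), hRAdom l _⟩))
    -- the resolvent (λ - G_r)⁻¹ of G_r = A + r B (0 ≤ r < 1), which generates a
    -- substochastic C₀-semigroup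
    (RGr : ℝ → ℝ → X →L[ℝ] X)
    (hRGrdom : ∀ (r l : ℝ) (u : X), RGr r l u ∈ A.domain)
    (hRGreq : ∀ (r : ℝ), 0 ≤ r → r < 1 → ∀ (l : ℝ), 0 < l → ∀ u : X,
      l • RGr r l u - A ⟨RGr r l u, hRGrdom r l u⟩ - r • B ⟨RGr r l u, hRGrdom r l u⟩ = u)
    (hRGrinv : ∀ (r : ℝ), 0 ≤ r → r < 1 → ∀ (l : ℝ), 0 < l → ∀ v : A.domain,
      RGr r l (l • (v : X) - A v - r • B v) = (v : X))
    (hSr : ∀ (r : ℝ), 0 ≤ r → r < 1 → ∃ Sr : ℝ → X →L[ℝ] X, IsSubstochastic Sr ∧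
      ∃ Gr : X →ₗ.[ℝ] X, IsGeneratorOf Gr Sr ∧ Gr.domain = A.domain ∧
        ∀ u : A.domain, ∀ h : (u : X) ∈ Gr.domain, Gr ⟨(u : X), h⟩ = A u + r • B u) :
    ∀ (l : ℝ), 0 < l → ∀ u : X,
      Tendsto (fun n : ℕ => Ψ ((Jfun A B (RA l) (hRAdom l))^[n] u)) atTop
        (𝓝 (xiRes Ψ A B G (RA l) (RG l) (hRAdom l) (hRGdom l) u)) ∧
      Tendsto (fun r : ℝ => (1 - r) * Ψ (B ⟨RGr r l u, hRGrdom r l u⟩))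
        (𝓝[Ico (0:ℝ) 1] 1)
        (𝓝 (xiRes Ψ A B G (RA l) (RG l) (hRAdom l) (hRGdom l) u)) := by
  intro l hl
  have h1 : ∀ u : X, Tendsto (fun n : ℕ => Ψ ((Jfun A B (RA l) (hRAdom l))^[n] u)) atTop
        (𝓝 (xiRes Ψ A B G (RA l) (RG l) (hRAdom l) (hRGdom l) u)) := by
    intro u
    have hs := ((hsum l hl u).hasSum.tendsto_sum_nat.comp (tendsto_add_atTop_nat 1))
    have hΨS := (Ψ.continuous.tendsto _).comp (hseries l hl u)
    have hG : -(Ψ (G ⟨RG l u, hRGdom l u⟩)) = Ψ u - l * Ψ (RG l u) := by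
      have := congrArg Ψ (hRGeq l hl u)
      simp only [map_sub, map_smul, smul_eq_mul] at this
      linarith
    rw [← tendsto_add_atTop_iff_nat 1]
    have hlim := ((tendsto_const_nhds (x := Ψ u)).sub (hΨS.const_mul l)).sub hs
    unfold xiRes abarRes
    rw [hG]
    refine hlim.congr fun n => ?_
    have hstep : ∀ w : X, aFun Ψ A B ⟨RA l w, hRAdom l w⟩
        = -(l * Ψ (RA l w)) + Ψ w - Ψ (Jfun A B (RA l) (hRAdom l) w) := by
      intro w
      have := congrArg Ψ (hRAeq l hl w)
      simp only [map_sub, map_smul, smul_eq_mul] at this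
      simp only [aFun, Jfun, map_add]
      linarith
    simp only [Function.comp, map_sum, hstep]
    clear hlim hs hΨS
    induction n with
    | zero =>
      simp
      ring
    | succ k ih =>
      rw [Finset.sum_range_succ, Finset.sum_range_succ _ (k + 1)]
      rw [Function.iterate_succ_apply' _ (k + 1)]
      linarith
  intro u
  refine ⟨h1 u, ?_⟩
  let J : X →ₗ[ℝ] X := B ∘ₗ (RA l).toLinearMap.codRestrict A.domain (hRAdom l)
  have hJ : Jfun A B (RA l) (hRAdom l) = ⇑J := rfl
  rw [hJ] at h1
  set L := xiRes Ψ A B G (RA l) (RG l) (hRAdom l) (hRGdom l) u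
  have hc : Tendsto (fun n : ℕ => Ψ (J^[n + 1] u)) atTop (𝓝 L) :=
    (tendsto_add_atTop_iff_nat (f := fun n : ℕ => Ψ (J^[n] u)) 1).2 (h1 u)
  obtain ⟨hsm, hab⟩ := abel_aux _ _ hc
  have hle : 𝓝[Ico (0:ℝ) 1] 1 ≤ 𝓝[<] (1:ℝ) := nhdsWithin_mono _ fun x hx => hx.2
  refine (hab.mono_left hle).congr' ?_
  filter_upwards [self_mem_nhdsWithin] with r hr
  congr 1
  obtain ⟨hr0, hr1⟩ := hr
  set v : A.domain := ⟨RGr r l u, hRGrdom r l u⟩ with hv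
  set y : X := l • (v : X) - A v with hy
  have hRy : RA l y = v := hRAinv l hl v
  have hJy : J y = B v := by
    change B ⟨RA l y, _⟩ = B v
    congr 1
    exact Subtype.ext hRy
  have hyu : y = u + r • J y := by
    have := hRGreq r hr0 hr1 l hl u
    rw [hJy, ← this]
    simp only [hy, hv]
    abel
  have hit : ∀ n : ℕ, Ψ (J y) = ∑ k ∈ Finset.range n, r ^ k * Ψ (J^[k + 1] u)
      + r ^ n * Ψ (J^[n + 1] y) := by
    intro n
    induction n with
    | zero => simp
    | succ k ih =>
      have e : Ψ (J^[k + 1] y) = Ψ (J^[k + 1] u) + r * Ψ (J^[k + 2] y) := by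
        conv_lhs => rw [hyu]
        rw [← Module.End.pow_apply, map_add, map_smul, map_add, map_smul, smul_eq_mul,
          Module.End.pow_apply, Module.End.pow_apply, ← Function.iterate_succ_apply]
      rw [Finset.sum_range_succ, ih, e]
      ring
  have ht := (hsm r hr0 hr1).hasSum.tendsto_sum_nat
  have hz : Tendsto (fun n : ℕ => r ^ n * Ψ (J^[n + 1] y)) atTop (𝓝 0) := by
    have h := (tendsto_pow_atTop_nhds_zero_of_lt_one hr0 hr1).mul
      ((tendsto_add_atTop_iff_nat (f := fun n : ℕ => Ψ (J^[n] y)) 1).2 (h1 y))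
    simpa using h
  have hall := ht.add hz
  rw [add_zero] at hall
  have := hall.congr fun n => (hit n).symm
  rw [← hJy]
  exact tendsto_nhds_unique this tendsto_const_nhds
end
end

section
/- Let (Σ, 𝓕) be a measurable space and let M(Σ,𝓕) be the Banach space of bounded signed measures on (Σ,𝓕) with the total variation norm. A subspace 𝓐 of M(Σ,𝓕) is an M-ideal (i.e., 𝓐 is closed and for every μ ∈ 𝓐 and ν ∈ M(Σ,𝓕), ν absolutely continuous with respect to |μ| implies ν ∈ 𝓐) if and only if 𝓐 is a closed, positively generated order ideal of M(Σ,𝓕) (i.e., 𝓐 = (𝓐 ∩ M₊) − (𝓐 ∩ M₊) and μ₁ ≤ ν ≤ μ₂ with μ₁,μ₂ ∈ 𝓐 implies ν ∈ 𝓐). -/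
open Filter Topology Set MeasureTheory
open scoped ENNReal

noncomputable section

variable {σ : Type*} [MeasurableSpace σ]

/-- A set of bounded signed measures is closed with respect to the total variation norm
(expressed sequentially, which is equivalent in a metric space). -/
def ClosedInTotalVariation (𝓐 : Set (SignedMeasure σ)) : Prop :=
  ∀ f : ℕ → SignedMeasure σ, (∀ n, f n ∈ 𝓐) → ∀ μ : SignedMeasure σ,
    Tendsto (fun n => (f n - μ).totalVariation Set.univ) atTop (𝓝 (0 : ℝ≥0∞)) → μ ∈ 𝓐

/-- `ν` is absolutely continuous with respect to `|μ|`. -/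
def AbsContTV (ν μ : SignedMeasure σ) : Prop :=
  ∀ s : Set σ, MeasurableSet s → μ.totalVariation s = 0 → ν s = 0

theorem exists_measure_of_nonneg (l : SignedMeasure σ) (hl : 0 ≤ l) :
    ∃ m : Measure σ, ∃ _ : IsFiniteMeasure m, m.toSignedMeasure = l := by
  have h0 : VectorMeasure.restrict 0 Set.univ ≤ VectorMeasure.restrict l Set.univ :=
    (VectorMeasure.le_restrict_univ_iff_le _ _).2 hl
  exact ⟨l.toMeasureOfZeroLE Set.univ MeasurableSet.univ h0, inferInstance,
    SignedMeasure.toMeasureOfZeroLE_toSignedMeasure l h0⟩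

theorem tv_withDensity_univ (m : Measure σ) [IsFiniteMeasure m] (g : σ → ℝ)
    (hg : Integrable g m) :
    SignedMeasure.totalVariation (m.withDensityᵥ g) Set.univ
      = ∫⁻ a, ENNReal.ofReal ‖g a‖ ∂m := by
  rw [SignedMeasure.totalVariation_eq_variation, Measure.variation_withDensityᵥ hg,
    withDensity_apply _ MeasurableSet.univ, Measure.restrict_univ]
  simp only [ofReal_norm]

theorem mem_of_ac (𝓐 : Set (SignedMeasure σ))
    (hsmul : ∀ (c : ℝ), ∀ μ ∈ 𝓐, c • μ ∈ 𝓐)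
    (hc : ClosedInTotalVariation 𝓐)
    (ho : ∀ μ₁ ∈ 𝓐, ∀ μ₂ ∈ 𝓐, ∀ ν : SignedMeasure σ, μ₁ ≤ ν → ν ≤ μ₂ → ν ∈ 𝓐)
    (m : Measure σ) [IsFiniteMeasure m] (hm : m.toSignedMeasure ∈ 𝓐)
    (f : σ → ℝ) (hfm : Measurable f) (hf : Integrable f m) :
    (m.withDensityᵥ f : SignedMeasure σ) ∈ 𝓐 := by
  have hle : ∀ (n : ℕ) a, |max (-(n : ℝ)) (min (f a) n)| ≤ |f a| := by
    intro n a
    have hn : (0 : ℝ) ≤ n := n.cast_nonneg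
    rw [abs_le]
    constructor
    · exact le_max_of_le_right (le_min (neg_abs_le _) (by linarith [abs_nonneg (f a)]))
    · exact max_le (by linarith [abs_nonneg (f a)]) (min_le_of_left_le (le_abs_self _))
  have hFm : ∀ n : ℕ, Measurable (fun a => max (-(n : ℝ)) (min (f a) n)) := fun n => by fun_prop
  have hF : ∀ n : ℕ, Integrable (fun a => max (-(n : ℝ)) (min (f a) n)) m := fun n =>
    hf.mono (hFm n).aestronglyMeasurable (.of_forall (hle n))
  refine hc (fun n => m.withDensityᵥ (fun a => max (-(n : ℝ)) (min (f a) n))) (fun n => ?_) _ ?_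
  · refine ho _ (hsmul (-(n : ℝ)) _ hm) _ (hsmul n _ hm) _ ?_ ?_
    · intro s hs
      rw [withDensityᵥ_apply (hF n) hs, smul_apply,
        Measure.toSignedMeasure_apply_measurable hs]
      calc -(n : ℝ) • m.real s = ∫ _ in s, -(n : ℝ) ∂m := by simp [mul_comm]
        _ ≤ _ := integral_mono (integrable_const _) (hF n).integrableOn
              (fun a => le_max_left _ _)
    · intro s hs
      rw [withDensityᵥ_apply (hF n) hs, smul_apply,
        Measure.toSignedMeasure_apply_measurable hs]
      calc _ ≤ ∫ _ in s, (n : ℝ) ∂m := integral_mono (hF n).integrableOn (integrable_const _)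
              (fun a => max_le (by linarith [(n.cast_nonneg : (0 : ℝ) ≤ n)]) (min_le_right _ _))
        _ = (n : ℝ) • m.real s := by simp [mul_comm]
  · have key := tendsto_lintegral_norm_of_dominated_convergence (μ := m) (f := f)
      (F := fun (n : ℕ) a => max (-(n : ℝ)) (min (f a) n)) (bound := fun a => |f a|)
      (fun n => (hFm n).aestronglyMeasurable) hf.abs.2 (fun n => .of_forall (hle n))
      (.of_forall fun a => by
        obtain ⟨N, hN⟩ := exists_nat_ge |f a|
        refine tendsto_const_nhds.congr' ?_
        filter_upwards [eventually_ge_atTop N] with n hn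
        have h1 : |f a| ≤ n := hN.trans (by exact_mod_cast hn)
        rw [abs_le] at h1
        rw [min_eq_left h1.2, max_eq_right h1.1])
    refine key.congr fun n => ?_
    rw [← withDensityᵥ_sub (hF n) hf, tv_withDensity_univ _ _ ((hF n).sub hf)]
    rfl

theorem ac_part (μ : SignedMeasure σ) (p : Measure σ) [IsFiniteMeasure p]
    (hp : p ≤ μ.totalVariation) : AbsContTV p.toSignedMeasure μ := by
  intro s hs h
  have : p s = 0 := le_antisymm ((hp s).trans h.le) zero_le
  simp [Measure.toSignedMeasure_apply_measurable hs, measureReal_def, this]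

/-- A subspace `𝓐` of the space `M(Σ,𝓕)` of bounded signed measures (with the total
variation norm) is an `M`-ideal (closed, and `μ ∈ 𝓐`, `ν ≪ |μ|` imply `ν ∈ 𝓐`) if and only
if it is a closed, positively generated order ideal. -/
theorem mIdeal_iff_closed_positively_generated_order_ideal
    (𝓐 : Set (SignedMeasure σ))
    -- 𝓐 is a (linear) subspace of M(Σ,𝓕)
    (hsub : ∃ S : Submodule ℝ (SignedMeasure σ), (S : Set (SignedMeasure σ)) = 𝓐) :
    -- 𝓐 is an M-ideal ...
    (ClosedInTotalVariation 𝓐 ∧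
      ∀ μ ∈ 𝓐, ∀ ν : SignedMeasure σ, AbsContTV ν μ → ν ∈ 𝓐) ↔
    -- ... iff 𝓐 is closed, positively generated and an order ideal
    (ClosedInTotalVariation 𝓐 ∧
      (∀ μ ∈ 𝓐, ∃ μ₁ ∈ 𝓐, ∃ μ₂ ∈ 𝓐, 0 ≤ μ₁ ∧ 0 ≤ μ₂ ∧ μ = μ₁ - μ₂) ∧
      (∀ μ₁ ∈ 𝓐, ∀ μ₂ ∈ 𝓐, ∀ ν : SignedMeasure σ, μ₁ ≤ ν → ν ≤ μ₂ → ν ∈ 𝓐)) := by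
  obtain ⟨S, rfl⟩ := hsub
  constructor
  · rintro ⟨hc, hac⟩
    refine ⟨hc, ?_, ?_⟩
    · intro μ hμ
      refine ⟨μ.toJordanDecomposition.posPart.toSignedMeasure, hac μ hμ _ (ac_part _ _ ?_),
        μ.toJordanDecomposition.negPart.toSignedMeasure, hac μ hμ _ (ac_part _ _ ?_),
        Measure.zero_le_toSignedMeasure _, Measure.zero_le_toSignedMeasure _,
        (SignedMeasure.toSignedMeasure_toJordanDecomposition μ).symm⟩
      · exact Measure.le_add_right le_rfl
      · exact Measure.le_add_left le_rfl
    · intro μ₁ h₁ μ₂ h₂ ν hν₁ hν₂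
      have hl : μ₁.totalVariation.toSignedMeasure + μ₂.totalVariation.toSignedMeasure
          ∈ (S : Set (SignedMeasure σ)) :=
        S.add_mem (hac _ h₁ _ (ac_part _ _ le_rfl)) (hac _ h₂ _ (ac_part _ _ le_rfl))
      refine hac _ hl ν ?_
      intro s hs h
      have h0 := SignedMeasure.null_of_totalVariation_zero _ h
      rw [add_apply, Measure.toSignedMeasure_apply_measurable hs,
        Measure.toSignedMeasure_apply_measurable hs] at h0
      have p1 : 0 ≤ μ₁.totalVariation.real s := measureReal_nonneg
      have p2 : 0 ≤ μ₂.totalVariation.real s := measureReal_nonneg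
      have z1 : μ₁.totalVariation s = 0 := (measureReal_eq_zero_iff).1 (by linarith)
      have z2 : μ₂.totalVariation s = 0 := (measureReal_eq_zero_iff).1 (by linarith)
      have e1 := SignedMeasure.null_of_totalVariation_zero _ z1
      have e2 := SignedMeasure.null_of_totalVariation_zero _ z2
      have := hν₁ s hs
      have := hν₂ s hs
      linarith
  · rintro ⟨hc, hpg, ho⟩
    refine ⟨hc, ?_⟩
    intro μ hμ ν hν
    obtain ⟨μ₁, h₁, μ₂, h₂, p₁, p₂, rfl⟩ := hpg μ hμ
    obtain ⟨m, _, hm⟩ := exists_measure_of_nonneg (μ₁ + μ₂) (add_nonneg p₁ p₂)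
    have hac : (μ₁ - μ₂) ≪ᵥ m.toENNRealVectorMeasure := by
      refine VectorMeasure.AbsolutelyContinuous.mk fun s hs h => ?_
      rw [Measure.toENNRealVectorMeasure_apply_measurable hs] at h
      have e : m.toSignedMeasure s = 0 := by
        simp [Measure.toSignedMeasure_apply_measurable hs, measureReal_def, h]
      rw [hm, add_apply] at e
      have q1 : 0 ≤ μ₁ s := p₁ s hs
      have q2 : 0 ≤ μ₂ s := p₂ s hs
      rw [sub_apply]
      linarith
    rw [SignedMeasure.absolutelyContinuous_ennreal_iff,
      VectorMeasure.ennrealToMeasure_toENNRealVectorMeasure] at hac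
    have hν' : ν ≪ᵥ m.toENNRealVectorMeasure := by
      refine VectorMeasure.AbsolutelyContinuous.mk fun s hs h => ?_
      rw [Measure.toENNRealVectorMeasure_apply_measurable hs] at h
      exact hν s hs (hac h)
    rw [← SignedMeasure.withDensityᵥ_rnDeriv_eq ν m hν']
    exact mem_of_ac _ (fun c μ h => S.smul_mem c h) hc ho m (hm ▸ S.add_mem h₁ h₂) _
      (SignedMeasure.measurable_rnDeriv _ _) (SignedMeasure.integrable_rnDeriv _ _)
end
end

section
/- For every n ≥ 1 the Dyson–Phillips iterates satisfy: (1) for any u ∈ D(A), the map t ∈ (0,∞) ↦ V_n(t)u is continuously differentiable with d/dt V_n(t)u = V_n(t)Au + V_{n−1}(t)Bu; (2) for any u ∈ D(A) and t ≥ 0, V_n(t)u ∈ D(A), the map t ↦ A V_n(t)u is continuous, and A V_n(t)u = V_n(t)Au + V_{n−1}(t)Bu − B V_{n−1}(t)u; (3) for any u ∈ X and t ≥ 0, ∫₀ᵗ V_n(s)u ds ∈ D(A), the map t ↦ A ∫₀ᵗ V_n(s)u ds is continuous, and A ∫₀ᵗ V_n(s)u ds = V_n(t)u − B ∫₀ᵗ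 V_{n−1}(s)u ds; (4) for any u ∈ X and λ > 0, the integral ∫₀^∞ e^{−λs} V_n(s)u ds converges in the graph norm of A and (λ−A) ∫₀^∞ e^{−λs} V_n(s)u ds = B ∫₀^∞ e^{−λs} V_{n−1}(s)u ds. -/
open Filter Topology Set MeasureTheory

noncomputable section

variable {X : Type*} [NormedAddCommGroup X] [NormedSpace ℝ X] [CompleteSpace X] [PartialOrder X]

section DPHelpers

variable {E F : Type*} [NormedAddCommGroup E] [NormedSpace ℝ E] [CompleteSpace E]
  [NormedAddCommGroup F] [NormedSpace ℝ F]

theorem dp_local_bound (S : ℝ → E →L[ℝ] F) (hS : ∀ x, Continuous (fun t => S t x)) (a b : ℝ) :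
    ∃ M, ∀ t ∈ Icc a b, ‖S t‖ ≤ M := by
  obtain ⟨C, hC⟩ := banach_steinhaus (g := fun i : Icc a b => S i) (by
    intro x
    obtain ⟨C, hC⟩ := isCompact_Icc.exists_bound_of_continuousOn (s := Icc a b)
      (f := fun t => S t x) (hS x).continuousOn
    exact ⟨C, fun i => hC i i.2⟩)
  exact ⟨C, fun t ht => hC ⟨t, ht⟩⟩

theorem dp_joint {Y : Type*} [TopologicalSpace Y] (S : ℝ → E →L[ℝ] F)
    (hS : ∀ x, Continuous (fun t => S t x)) {g : Y → ℝ} {f : Y → E}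
    (hg : Continuous g) (hf : Continuous f) : Continuous (fun y => S (g y) (f y)) := by
  rw [continuous_iff_continuousAt]
  intro y0
  obtain ⟨M, hM⟩ := dp_local_bound S hS (g y0 - 1) (g y0 + 1)
  have h1 : Tendsto (fun y => S (g y) (f y0)) (𝓝 y0) (𝓝 (S (g y0) (f y0))) :=
    ((hS (f y0)).comp hg).tendsto y0
  have h2 : Tendsto (fun y => S (g y) (f y - f y0)) (𝓝 y0) (𝓝 0) := by
    have h3 : Tendsto (fun y => M * ‖f y - f y0‖) (𝓝 y0) (𝓝 0) := by
      have : Continuous (fun y => M * ‖f y - f y0‖) := by fun_prop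
      simpa using this.tendsto y0
    refine squeeze_zero_norm' ?_ h3
    have : ∀ᶠ y in 𝓝 y0, g y ∈ Icc (g y0 - 1) (g y0 + 1) :=
      hg.continuousAt (Icc_mem_nhds (by linarith) (by linarith))
    filter_upwards [this] with y hy
    exact (S (g y)).le_of_opNorm_le (hM _ hy) _
  have := h1.add h2
  simp only [map_sub, add_zero] at this
  refine this.congr ?_
  intro y; abel

theorem dp_int_clm (S : ℝ → E →L[ℝ] F) (hS : ∀ x, Continuous (fun t => S t x)) (t : ℝ) :
    ∃ I : E →L[ℝ] F, ∀ x, I x = ∫ s in (0:ℝ)..t, S s x := by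
  obtain ⟨M, hM⟩ := dp_local_bound S hS (min 0 t) (max 0 t)
  refine ⟨LinearMap.mkContinuous
    { toFun := fun x => ∫ s in (0:ℝ)..t, S s x
      map_add' := ?_
      map_smul' := ?_ } (M * |t - 0|) ?_, fun x => rfl⟩
  · intro x y
    simp only [map_add]
    exact intervalIntegral.integral_add ((hS x).intervalIntegrable _ _)
      ((hS y).intervalIntegrable _ _)
  · intro c x
    simp only [map_smul, RingHom.id_apply]
    exact intervalIntegral.integral_smul _ _
  · intro x
    have : ‖∫ s in (0:ℝ)..t, S s x‖ ≤ (M * ‖x‖) * |t - 0| := by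
      apply intervalIntegral.norm_integral_le_of_norm_le_const
      intro s hs
      exact (S s).le_of_opNorm_le (hM _ (uIoc_subset_uIcc hs)) _
    calc _ ≤ (M * ‖x‖) * |t - 0| := this
      _ = _ := by ring

theorem dp_triangle (K : ℝ → ℝ → F) (hK : Continuous (fun p : ℝ × ℝ => K p.1 p.2)) (T : ℝ)
    (hT : 0 ≤ T) :
    (∫ t in (0:ℝ)..T, ∫ s in (0:ℝ)..t, K t s) = ∫ s in (0:ℝ)..T, ∫ t in s..T, K t s := by
  set k : ℝ → ℝ → F := fun t s => indicator {p : ℝ × ℝ | p.2 ≤ p.1} (fun p => K p.1 p.2) (t, s)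
    with hk
  have hint : Integrable (Function.uncurry k)
      ((volume.restrict (Ioc 0 T)).prod (volume.restrict (Ioc 0 T))) := by
    have h1 : Integrable (fun p : ℝ × ℝ => K p.1 p.2)
      ((volume.restrict (Ioc 0 T)).prod (volume.restrict (Ioc 0 T))) := by
      rw [Measure.prod_restrict]
      have : IntegrableOn (fun p : ℝ × ℝ => K p.1 p.2) (Icc 0 T ×ˢ Icc 0 T)
          ((volume : Measure ℝ).prod volume) :=
        hK.continuousOn.integrableOn_compact (isCompact_Icc.prod isCompact_Icc)
      exact this.mono_set (prod_mono Ioc_subset_Icc_self Ioc_subset_Icc_self)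
    exact h1.indicator (measurableSet_le measurable_snd measurable_fst)
  have hsw := integral_integral_swap hint
  rw [intervalIntegral.integral_of_le hT, intervalIntegral.integral_of_le hT]
  calc _ = ∫ t in Ioc 0 T, ∫ s in Ioc 0 T, k t s := by
        apply setIntegral_congr_fun measurableSet_Ioc
        intro t ht
        have : k t = indicator (Iic t) (fun s => K t s) := by
          ext s; simp [hk, indicator]
        simp only [this]
        rw [setIntegral_indicator measurableSet_Iic, intervalIntegral.integral_of_le ht.1.le,
          Ioc_inter_Iic, min_eq_right ht.2]
    _ = ∫ s in Ioc 0 T, ∫ t in Ioc 0 T, k t s := hsw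
    _ = _ := by
        apply setIntegral_congr_fun measurableSet_Ioc
        intro s hs
        have : (fun t => k t s) = indicator (Ici s) (fun t => K t s) := by
          ext t; simp [hk, indicator]
        simp only [this]
        rw [setIntegral_indicator measurableSet_Ici, intervalIntegral.integral_of_le hs.2,
          ← integral_Icc_eq_integral_Ioc]
        congr 2
        ext t
        simp only [mem_inter_iff, mem_Ioc, mem_Ici, mem_Icc]
        constructor
        · rintro ⟨⟨h1, h2⟩, h3⟩; exact ⟨h3, h2⟩
        · rintro ⟨h1, h2⟩; exact ⟨⟨hs.1.trans_le h1, h2⟩, h1⟩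

theorem dp_fub1 (S : ℝ → E →L[ℝ] F) (hS : ∀ x, Continuous (fun t => S t x))
    (f : ℝ → E) (hf : Continuous f) (T : ℝ) (hT : 0 ≤ T) :
    (∫ t in (0:ℝ)..T, ∫ s in (0:ℝ)..t, S (t - s) (f s)) =
      ∫ s in (0:ℝ)..T, ∫ r in (0:ℝ)..(T - s), S r (f s) := by
  rw [dp_triangle (fun t s => S (t - s) (f s))
    (dp_joint S hS (by fun_prop) (by fun_prop)) T hT]
  congr 1
  ext s
  rw [intervalIntegral.integral_comp_sub_right (fun r => S r (f s)) s, sub_self]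

theorem dp_fub2 [CompleteSpace F] (S : ℝ → E →L[ℝ] F) (hS : ∀ x, Continuous (fun t => S t x))
    (f : ℝ → E) (hf : Continuous f) (T : ℝ) (hT : 0 ≤ T) :
    (∫ t in (0:ℝ)..T, ∫ s in (0:ℝ)..t, S (t - s) (f s)) =
      ∫ s in (0:ℝ)..T, S (T - s) (∫ r in (0:ℝ)..s, f r) := by
  have h1 : ∀ t : ℝ, (∫ s in (0:ℝ)..t, S (t - s) (f s)) = ∫ s in (0:ℝ)..t, S s (f (t - s)) := by
    intro t
    have := intervalIntegral.integral_comp_sub_left (fun s => S s (f (t - s))) t (a := 0) (b := t)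
    simpa using this
  simp only [h1]
  rw [dp_triangle (fun t s => S s (f (t - s)))
    (dp_joint S hS (by fun_prop) (by fun_prop)) T hT]
  have h2 := intervalIntegral.integral_comp_sub_left
    (fun s => S s (∫ r in (0:ℝ)..(T - s), f r)) T (a := 0) (b := T)
  simp only [sub_sub_cancel, sub_self, sub_zero] at h2
  rw [h2]
  congr 1
  ext s
  rw [ContinuousLinearMap.intervalIntegral_comp_comm _ ((by fun_prop : Continuous fun t => f (t - s)).intervalIntegrable _ _),
    intervalIntegral.integral_comp_sub_right f s, sub_self]

end DPHelpers

section DPCore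

variable {Z : Type*} [NormedAddCommGroup Z] [NormedSpace ℝ Z] [CompleteSpace Z]

theorem dp_congr {F : Type*} [NormedAddCommGroup F] [NormedSpace ℝ F] {f g : ℝ → F} {t : ℝ}
    (ht : 0 ≤ t) (h : ∀ s, 0 ≤ s → s ≤ t → f s = g s) :
    (∫ s in (0:ℝ)..t, f s) = ∫ s in (0:ℝ)..t, g s := by
  apply intervalIntegral.integral_congr
  intro s hs
  rw [uIcc_of_le ht] at hs
  exact h s hs.1 hs.2

/-- first projection -/
def dpFst (Γ : Submodule ℝ (Z × Z)) : Γ →L[ℝ] Z := (ContinuousLinearMap.fst ℝ Z Z).comp Γ.subtypeL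
/-- second projection -/
def dpSnd (Γ : Submodule ℝ (Z × Z)) : Γ →L[ℝ] Z := (ContinuousLinearMap.snd ℝ Z Z).comp Γ.subtypeL

theorem dpFst_apply (Γ : Submodule ℝ (Z × Z)) (γ : Γ) : dpFst Γ γ = γ.1.1 := rfl
theorem dpSnd_apply (Γ : Submodule ℝ (Z × Z)) (γ : Γ) : dpSnd Γ γ = γ.1.2 := rfl

/-- admissible pair of families at level `n` -/
def DPGood (Γ : Submodule ℝ (Z × Z)) (b : Γ →L[ℝ] Z) (J0 : ℝ → Z →L[ℝ] Γ)
    (w : ℝ → Z →L[ℝ] Z) (J : ℝ → Z →L[ℝ] Γ) (E : ℝ → Z →L[ℝ] Z) : Prop :=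
  (∀ x, Continuous (fun t => J t x)) ∧ (∀ x, Continuous (fun t => E t x)) ∧
  (∀ t, 0 ≤ t → ∀ x, (J t x).1.1 = ∫ s in (0:ℝ)..t, w s x) ∧
  (∀ t, 0 ≤ t → ∀ x, (J t x).1.2 = w t x - E t x) ∧
  (∀ γ : Γ, ∀ t, 0 ≤ t →
    (∫ s in (0:ℝ)..t, E (t - s) (b (γ + J0 s γ.1.2))) = b (J t γ.1.1))

theorem dp_step (Γ : Submodule ℝ (Z × Z)) (hΓ : IsClosed (Γ : Set (Z × Z)))
    (hinj : ∀ γ γ' : Γ, γ.1.1 = γ'.1.1 → γ = γ')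
    (hdense : Dense (range (fun γ : Γ => γ.1.1)))
    (b : Γ →L[ℝ] Z) (J0 : ℝ → Z →L[ℝ] Γ) (hJ0 : ∀ x, Continuous (fun t => J0 t x))
    (w w' : ℝ → Z →L[ℝ] Z) (hw : ∀ x, Continuous (fun t => w t x))
    (hw' : ∀ x, Continuous (fun t => w' t x))
    (hrec : ∀ t, 0 ≤ t → ∀ γ : Γ,
      w' t γ.1.1 = ∫ s in (0:ℝ)..t, w (t - s) (b (γ + J0 s γ.1.2)))
    (J : ℝ → Z →L[ℝ] Γ) (E : ℝ → Z →L[ℝ] Z) (hg : DPGood Γ b J0 w J E) :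
    ∃ J', DPGood Γ b J0 w' J' (fun t => b.comp (J t)) := by
  obtain ⟨hJ, hE, hfst, hsnd, hK⟩ := hg
  have : CompleteSpace Γ := hΓ.completeSpace_coe
  choose I hI using dp_int_clm w' hw'
  have hf : ∀ γ : Γ, Continuous (fun s => b (γ + J0 s γ.1.2)) := fun γ =>
    b.continuous.comp (continuous_const.add (hJ0 _))
  have hker : ∀ γ : Γ, ∀ t : ℝ, Continuous (fun s => J (t - s) (b (γ + J0 s γ.1.2))) :=
    fun γ t => dp_joint J hJ (by fun_prop) (hf γ)
  have hfstω : ∀ γ : Γ, ∀ t, 0 ≤ t →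
      (∫ s in (0:ℝ)..t, J (t - s) (b (γ + J0 s γ.1.2))).1.1 = ∫ s in (0:ℝ)..t, w' s γ.1.1 := by
    intro γ t ht
    rw [← dpFst_apply, ← ContinuousLinearMap.intervalIntegral_comp_comm _
      ((hker γ t).intervalIntegrable _ _)]
    have h1 := dp_fub1 w hw _ (hf γ) t ht
    rw [dp_congr ht (fun s hs _ => hrec s hs γ), h1]
    refine dp_congr ht (fun s hs hst => ?_)
    rw [dpFst_apply, hfst _ (by linarith)]
  have hsndω : ∀ γ : Γ, ∀ t, 0 ≤ t →
      (∫ s in (0:ℝ)..t, J (t - s) (b (γ + J0 s γ.1.2))).1.2 =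
        w' t γ.1.1 - b (J t γ.1.1) := by
    intro γ t ht
    rw [← dpSnd_apply, ← ContinuousLinearMap.intervalIntegral_comp_comm _
      ((hker γ t).intervalIntegrable _ _), hrec t ht, ← hK γ t ht,
      ← intervalIntegral.integral_sub]
    · refine dp_congr ht (fun s hs hst => ?_)
      rw [dpSnd_apply, hsnd _ (by linarith)]
    · exact (dp_joint w hw (by fun_prop) (hf γ)).intervalIntegrable _ _
    · exact (dp_joint E hE (by fun_prop) (hf γ)).intervalIntegrable _ _
  let P : ℝ → Z →L[ℝ] Z × Z := fun t => (I t).prod (w' t - b.comp (J t))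
  have hP : ∀ t, 0 ≤ t → ∀ x, P t x ∈ Γ := by
    intro t ht x
    have hcl : IsClosed {x | P t x ∈ Γ} := hΓ.preimage (P t).continuous
    have hsub : range (fun γ : Γ => γ.1.1) ⊆ {x | P t x ∈ Γ} := by
      rintro _ ⟨γ, rfl⟩
      have : P t γ.1.1 = (∫ s in (0:ℝ)..t, J (t - s) (b (γ + J0 s γ.1.2))).1 := by
        ext
        · rw [hfstω γ t ht]; simp [P, hI]
        · rw [hsndω γ t ht]; simp [P]
      simp only [mem_ofPred_eq]
      rw [this]
      exact Subtype.property _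
    have := closure_minimal hsub hcl
    rw [hdense.closure_eq] at this
    exact this (mem_univ x)
  let J' : ℝ → Z →L[ℝ] Γ := fun t =>
    (P (max t 0)).codRestrict Γ (hP _ (le_max_right _ _))
  have hJ'1 : ∀ t, 0 ≤ t → ∀ x, (J' t x).1 = P t x := by
    intro t ht x
    simp only [J', max_eq_left ht]
    rfl
  refine ⟨J', ?_, ?_, ?_, ?_, ?_⟩
  · intro x
    refine Continuous.subtype_mk (f := fun t => P (max t 0) x) ?_ _
    refine Continuous.comp (g := fun t => P t x) ?_ (by fun_prop)
    have : (fun t => P t x) = fun t => (∫ s in (0:ℝ)..t, w' s x, w' t x - b (J t x)) := by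
      ext t
      · simp [P, hI]
      · simp [P]
    rw [this]
    exact (intervalIntegral.continuous_primitive
      (fun a c => (hw' x).intervalIntegrable a c) 0).prodMk
      ((hw' x).sub (b.continuous.comp (hJ x)))
  · intro x
    exact b.continuous.comp (hJ x)
  · intro t ht x
    rw [hJ'1 t ht]; simp [P, hI]
  · intro t ht x
    rw [hJ'1 t ht]; simp [P]
  · intro γ t ht
    have h2 : (∫ s in (0:ℝ)..t, J (t - s) (b (γ + J0 s γ.1.2))) = J' t γ.1.1 := by
      apply hinj
      rw [hfstω γ t ht, hJ'1 t ht]; simp [P, hI]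
    rw [← h2, ← ContinuousLinearMap.intervalIntegral_comp_comm _
      ((hker γ t).intervalIntegrable _ _)]
    rfl

theorem dp_core (Γ : Submodule ℝ (Z × Z)) (hΓ : IsClosed (Γ : Set (Z × Z)))
    (hinj : ∀ γ γ' : Γ, γ.1.1 = γ'.1.1 → γ = γ')
    (hdense : Dense (range (fun γ : Γ => γ.1.1)))
    (b : Γ →L[ℝ] Z) (J0 : ℝ → Z →L[ℝ] Γ) (hJ0 : ∀ x, Continuous (fun t => J0 t x))
    (v : ℕ → ℝ → Z →L[ℝ] Z) (hv : ∀ n x, Continuous (fun t => v n t x))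
    (hJ0f : ∀ t, 0 ≤ t → ∀ x, (J0 t x).1.1 = ∫ s in (0:ℝ)..t, v 0 s x)
    (hJ0s : ∀ t, 0 ≤ t → ∀ x, (J0 t x).1.2 = v 0 t x - x)
    (hv0 : ∀ t, 0 ≤ t → ∀ γ : Γ, v 0 t γ.1.1 = γ.1.1 + ∫ s in (0:ℝ)..t, v 0 s γ.1.2)
    (hrec : ∀ n t, 0 ≤ t → ∀ γ : Γ,
      v (n + 1) t γ.1.1 = ∫ s in (0:ℝ)..t, v n (t - s) (b (γ + J0 s γ.1.2))) :
    ∃ J : ℕ → ℝ → Z →L[ℝ] Γ, J 0 = J0 ∧ (∀ n x, Continuous (fun t => J n t x)) ∧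
      (∀ n t, 0 ≤ t → ∀ x, (J n t x).1.1 = ∫ s in (0:ℝ)..t, v n s x) ∧
      (∀ n t, 0 ≤ t → ∀ x, (J (n + 1) t x).1.2 = v (n + 1) t x - b (J n t x)) ∧
      (∀ n t, 0 ≤ t → ∀ γ : Γ, v (n + 1) t γ.1.1 =
        (∫ s in (0:ℝ)..t, v n s (b γ)) + ∫ s in (0:ℝ)..t, v (n + 1) s γ.1.2) := by
  have : CompleteSpace Γ := hΓ.completeSpace_coe
  have hf : ∀ γ : Γ, Continuous (fun s => γ + J0 s γ.1.2) := fun γ =>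
    (continuous_const.add (hJ0 _))
  have hK0 : ∀ γ : Γ, ∀ t, 0 ≤ t →
      (∫ s in (0:ℝ)..t, b (γ + J0 s γ.1.2)) = b (J0 t γ.1.1) := by
    intro γ t ht
    rw [ContinuousLinearMap.intervalIntegral_comp_comm _ ((hf γ).intervalIntegrable _ _)]
    congr 1
    apply hinj
    rw [← dpFst_apply, ← ContinuousLinearMap.intervalIntegral_comp_comm _
      ((hf γ).intervalIntegrable _ _), hJ0f t ht]
    refine dp_congr ht (fun s hs hst => ?_)
    rw [map_add, dpFst_apply, dpFst_apply, hJ0f s hs, hv0 s hs]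
  have g0 : DPGood Γ b J0 (v 0) J0 (fun _ => ContinuousLinearMap.id ℝ Z) :=
    ⟨hJ0, fun x => continuous_const, hJ0f, hJ0s, hK0⟩
  have hstep : ∀ n (p : {p : (ℝ → Z →L[ℝ] Γ) × (ℝ → Z →L[ℝ] Z) // DPGood Γ b J0 (v n) p.1 p.2}),
      ∃ q : {p : (ℝ → Z →L[ℝ] Γ) × (ℝ → Z →L[ℝ] Z) // DPGood Γ b J0 (v (n+1)) p.1 p.2},
        q.1.2 = fun t => b.comp (p.1.1 t) := by
    intro n p
    obtain ⟨J', hJ'⟩ := dp_step Γ hΓ hinj hdense b J0 hJ0 (v n) (v (n+1)) (hv n) (hv (n+1))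
      (hrec n) p.1.1 p.1.2 p.2
    exact ⟨⟨(J', _), hJ'⟩, rfl⟩
  choose f hfE using hstep
  let q : ∀ n, {p : (ℝ → Z →L[ℝ] Γ) × (ℝ → Z →L[ℝ] Z) // DPGood Γ b J0 (v n) p.1 p.2} :=
    fun n => Nat.rec ⟨(J0, _), g0⟩ (fun n p => f n p) n
  refine ⟨fun n => (q n).1.1, rfl, fun n => (q n).2.1, fun n => (q n).2.2.2.1, ?_, ?_⟩
  · intro n t ht x
    have h1 := (q (n+1)).2.2.2.2.1 t ht x
    have h2 : (q (n+1)).1.2 = fun t => b.comp ((q n).1.1 t) := hfE n (q n)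
    rw [h2] at h1
    exact h1
  · intro n t ht γ
    have hc : ∀ x, Continuous (fun s => v n (t - s) (b (J0 s x))) := fun x =>
      dp_joint (v n) (hv n) (by fun_prop) (b.continuous.comp (hJ0 x))
    have key : ∀ x, (∫ s in (0:ℝ)..t, v n (t - s) (b (J0 s x))) =
        ∫ s in (0:ℝ)..t, v (n+1) s x := by
      obtain ⟨I, hI⟩ := dp_int_clm (v (n+1)) (hv (n+1)) t
      obtain ⟨I2, hI2⟩ := dp_int_clm (fun s => (v n (t - s)).comp (b.comp (J0 s))) hc t
      have : (I2 : Z → Z) = I := by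
        refine Continuous.ext_on hdense I2.continuous I.continuous ?_
        rintro _ ⟨γ, rfl⟩
        simp only [hI, hI2]
        rw [dp_congr ht (fun s hs _ => hrec n s hs γ),
          dp_fub2 (v n) (hv n) (fun s => b (γ + J0 s γ.1.2)) (b.continuous.comp (hf γ)) t ht]
        refine dp_congr ht (fun s hs hst => ?_)
        have := hK0 γ s hs
        simp only [ContinuousLinearMap.comp_apply]
        rw [this]
      intro x
      rw [← hI, ← this, hI2]
      rfl
    rw [hrec n t ht γ, ← key]
    have h3 : (∫ s in (0:ℝ)..t, v n s (b γ)) = ∫ s in (0:ℝ)..t, v n (t - s) (b γ) := by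
      have := intervalIntegral.integral_comp_sub_left (fun s => v n s (b γ)) t (a := 0) (b := t)
      simpa using this.symm
    rw [h3, ← intervalIntegral.integral_add]
    · simp only [map_add]
    · exact (dp_joint (v n) (hv n) (by fun_prop) continuous_const).intervalIntegrable _ _
    · exact (hc _).intervalIntegrable _ _

end DPCore

section DPLaplace

variable {Z : Type*} [NormedAddCommGroup Z] [NormedSpace ℝ Z] [CompleteSpace Z]

theorem dp_poly_exp (a : ℝ) (ha : 0 < a) (s : ℝ) (hs : 0 ≤ s) :
    1 + s ≤ (1 + a⁻¹) * Real.exp (a * s) := by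
  have h1 := Real.add_one_le_exp (a * s)
  have h2 : 0 ≤ a * s := by positivity
  have h3 : s ≤ a⁻¹ * Real.exp (a * s) := by
    rw [inv_mul_eq_div, le_div_iff₀ ha]; linarith
  nlinarith

theorem dp_lap_tendsto (j : ℝ → Z) (hj : Continuous j) (c l : ℝ) (hl : 0 < l)
    (hb : ∀ t, 0 ≤ t → ‖j t‖ ≤ c * (1 + t)) :
    Tendsto (fun t => Real.exp (-l * t) • j t) atTop (𝓝 0) ∧
    ∃ Λ, Tendsto (fun t => Real.exp (-l * t) • j t +
      l • ∫ s in (0:ℝ)..t, Real.exp (-l * s) • j s) atTop (𝓝 Λ) := by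
  have hc : 0 ≤ c := by
    have := (norm_nonneg _).trans (hb 0 le_rfl); simpa using this
  have ha : 0 < l / 2 := by positivity
  have hbd : ∀ t, 0 ≤ t →
      ‖Real.exp (-l * t) • j t‖ ≤ (c * (1 + (l/2)⁻¹)) * Real.exp (-(l/2) * t) := by
    intro t ht
    rw [norm_smul, Real.norm_eq_abs, abs_of_pos (Real.exp_pos _)]
    have h1 := dp_poly_exp (l/2) ha t ht
    have h2 : Real.exp (-(l/2) * t) = Real.exp (-l * t) * Real.exp ((l/2) * t) := by
      rw [← Real.exp_add]; congr 1; ring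
    rw [h2]
    calc _ ≤ Real.exp (-l * t) * (c * ((1 + (l/2)⁻¹) * Real.exp ((l/2) * t))) := by
          gcongr
          exact (hb t ht).trans (by gcongr)
      _ = _ := by ring
  have hz : Tendsto (fun t => Real.exp (-l * t) • j t) atTop (𝓝 0) := by
    have h4 : Tendsto (fun t : ℝ => (c * (1 + (l/2)⁻¹)) * Real.exp (-(l/2) * t)) atTop (𝓝 0) := by
      have : Tendsto (fun t : ℝ => Real.exp (-(l/2) * t)) atTop (𝓝 0) := by
        apply Real.tendsto_exp_atBot.comp
        exact tendsto_id.const_mul_atTop_of_neg (by linarith)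
      simpa using this.const_mul (c * (1 + (l/2)⁻¹))
    refine squeeze_zero_norm' ?_ h4
    filter_upwards [eventually_ge_atTop 0] with t ht using hbd t ht
  have hcont : Continuous (fun t => Real.exp (-l * t) • j t) := by fun_prop
  have hint : IntegrableOn (fun t => Real.exp (-l * t) • j t) (Ioi 0) := by
    refine Integrable.mono' ((exp_neg_integrableOn_Ioi 0 ha).const_mul (c * (1 + (l/2)⁻¹)))
      hcont.aestronglyMeasurable ?_
    filter_upwards [ae_restrict_mem measurableSet_Ioi] with t ht using hbd t (le_of_lt ht)
  exact ⟨hz, _, hz.add ((intervalIntegral_tendsto_integral_Ioi 0 hint tendsto_id).const_smul l)⟩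

theorem dp_lap_parts (w : ℝ → Z) (hw : Continuous w) (l t : ℝ) :
    (∫ s in (0:ℝ)..t, Real.exp (-l * s) • w s) =
      Real.exp (-l * t) • (∫ s in (0:ℝ)..t, w s) +
        l • ∫ s in (0:ℝ)..t, Real.exp (-l * s) • ∫ r in (0:ℝ)..s, w r := by
  have hy : Continuous (fun s => ∫ r in (0:ℝ)..s, w r) :=
    intervalIntegral.continuous_primitive (fun a c => hw.intervalIntegrable a c) 0
  have hd : ∀ s, HasDerivAt (fun s => Real.exp (-l * s) • ∫ r in (0:ℝ)..s, w r)
      (Real.exp (-l * s) • w s + (-l) • (Real.exp (-l * s) • ∫ r in (0:ℝ)..s, w r)) s := by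
    intro s
    have h1 : HasDerivAt (fun s : ℝ => Real.exp (-l * s)) (Real.exp (-l * s) * (-l * 1)) s :=
      ((hasDerivAt_id s).const_mul (-l)).exp
    have h2 : HasDerivAt (fun s => ∫ r in (0:ℝ)..s, w r) (w s) s :=
      intervalIntegral.integral_hasDerivAt_right (hw.intervalIntegrable _ _)
        (hw.stronglyMeasurableAtFilter _ _) hw.continuousAt
    have h12 := h1.smul h2
    refine h12.congr_deriv ?_
    rw [smul_smul]; congr 2; ring
  have h3 := intervalIntegral.integral_eq_sub_of_hasDerivAt (a := 0) (b := t)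
    (fun s _ => hd s) ((by fun_prop : Continuous (fun s => Real.exp (-l * s) • w s +
      (-l) • (Real.exp (-l * s) • ∫ r in (0:ℝ)..s, w r))).intervalIntegrable _ _)
  rw [intervalIntegral.integral_add
    ((by fun_prop : Continuous (fun s => Real.exp (-l * s) • w s)).intervalIntegrable _ _)
    ((by fun_prop : Continuous (fun s => (-l) • (Real.exp (-l * s) • ∫ r in (0:ℝ)..s, w r))).intervalIntegrable _ _),
    intervalIntegral.integral_smul] at h3
  simp only [intervalIntegral.integral_same, smul_zero, sub_zero, neg_smul] at h3
  rw [← h3]; abel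

end DPLaplace

section DPSemigroup

theorem dp_graph_iff {A : X →ₗ.[ℝ] X} {T : ℝ → X →L[ℝ] X} (hA : IsGeneratorOf A T) (u v : X) :
    (u, v) ∈ A.graph ↔ Tendsto (fun t : ℝ => t⁻¹ • (T t u - u)) (𝓝[>] 0) (𝓝 v) := by
  rw [LinearPMap.mem_graph_iff]
  constructor
  · rintro ⟨y, hy1, hy2⟩
    simp only at hy1 hy2
    rw [← hy1, ← hy2]
    exact hA.2 y
  · intro h
    have hu : u ∈ A.domain := (hA.1 u).2 ⟨v, h⟩
    exact ⟨⟨u, hu⟩, rfl, tendsto_nhds_unique (hA.2 ⟨u, hu⟩) h⟩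

theorem dp_ext_cont {T : ℝ → X →L[ℝ] X} (hT : ∀ u : X, ContinuousOn (fun t => T t u) (Ici (0 : ℝ)))
    (x : X) : Continuous (fun t => T (max t 0) x) :=
  (hT x).comp_continuous (by fun_prop) (fun t => mem_Ici.2 (le_max_right _ _))

theorem dp_sg_int {A : X →ₗ.[ℝ] X} {T : ℝ → X →L[ℝ] X} (hT : IsC0Semigroup T)
    (hA : IsGeneratorOf A T) {u v : X} (h : (u, v) ∈ A.graph) (t : ℝ) (ht : 0 ≤ t) :
    T t u - u = ∫ s in (0:ℝ)..t, T (max s 0) v := by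
  rw [dp_graph_iff hA] at h
  have hc := dp_ext_cont hT.strongCont
  have := intervalIntegral.integral_eq_sub_of_hasDeriv_right (a := 0) (b := t)
    (f := fun s => T (max s 0) u) (f' := fun s => T (max s 0) v) (hc u).continuousOn ?_
    ((hc v).intervalIntegrable _ _)
  · rw [this]; simp [max_eq_left ht, hT.map_zero]
  · intro s hs
    rw [min_eq_left ht, max_eq_right ht] at hs
    have hs0 : 0 ≤ s := hs.1.le
    rw [hasDerivWithinAt_iff_tendsto_slope' (by simp)]
    have h1 : Tendsto (fun r : ℝ => r - s) (𝓝[>] s) (𝓝[>] 0) := by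
      apply tendsto_nhdsWithin_of_tendsto_nhds_of_eventually_within
      · have : Continuous (fun r : ℝ => r - s) := by fun_prop
        simpa using (this.tendsto s).mono_left nhdsWithin_le_nhds
      · filter_upwards [self_mem_nhdsWithin] with r hr
        simpa using hr
    have h2 := ((T s).continuous.tendsto v).comp (h.comp h1)
    rw [max_eq_left hs0]
    refine h2.congr' ?_
    filter_upwards [self_mem_nhdsWithin] with r hr
    have hr' : s < r := hr
    simp only [Function.comp_apply, slope, vsub_eq_sub]
    rw [max_eq_left hs0, max_eq_left (hs0.trans hr'.le), map_smul, map_sub]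
    have : T r = (T s).comp (T (r - s)) := by
      rw [← hT.map_add s (r - s) hs0 (by linarith)]; congr 1; ring
    rw [this]; rfl

theorem dp_prim_tendsto (w : ℝ → X) (hw : Continuous w) :
    Tendsto (fun t : ℝ => t⁻¹ • ∫ s in (0:ℝ)..t, w s) (𝓝[>] 0) (𝓝 (w 0)) := by
  have h2 : HasDerivAt (fun s => ∫ r in (0:ℝ)..s, w r) (w 0) 0 :=
    intervalIntegral.integral_hasDerivAt_right (hw.intervalIntegrable _ _)
      (hw.stronglyMeasurableAtFilter _ _) hw.continuousAt
  have := h2.tendsto_slope_zero_right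
  simpa using this

theorem dp_sg_of_int {A : X →ₗ.[ℝ] X} {T : ℝ → X →L[ℝ] X} (hT : IsC0Semigroup T)
    (hA : IsGeneratorOf A T) {u v : X}
    (h : ∀ t, 0 ≤ t → T t u - u = ∫ s in (0:ℝ)..t, T (max s 0) v) : (u, v) ∈ A.graph := by
  rw [dp_graph_iff hA]
  have := dp_prim_tendsto _ (dp_ext_cont hT.strongCont v)
  simp only [max_self, hT.map_zero, ContinuousLinearMap.id_apply] at this
  refine this.congr' ?_
  filter_upwards [self_mem_nhdsWithin] with t ht
  rw [h t (le_of_lt ht)]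

theorem dp_sg_closed {A : X →ₗ.[ℝ] X} {T : ℝ → X →L[ℝ] X} (hT : IsC0Semigroup T)
    (hA : IsGeneratorOf A T) : IsClosed (A.graph : Set (X × X)) := by
  choose I hI using dp_int_clm (fun t => T (max t 0)) (dp_ext_cont hT.strongCont)
  have : (A.graph : Set (X × X)) = ⋂ t ∈ Ici (0:ℝ), {p : X × X | T t p.1 - p.1 = I t p.2} := by
    ext ⟨u, v⟩
    simp only [SetLike.mem_coe, mem_iInter]
    constructor
    · intro h t ht
      show T t u - u = I t v
      rw [hI, dp_sg_int hT hA h t ht]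
    · intro h
      apply dp_sg_of_int hT hA
      intro t ht
      rw [← hI]
      exact h t ht
  rw [this]
  refine isClosed_biInter fun t _ => isClosed_eq ?_ ?_ <;> fun_prop

theorem dp_sg_int_mem {A : X →ₗ.[ℝ] X} {T : ℝ → X →L[ℝ] X} (hT : IsC0Semigroup T)
    (hA : IsGeneratorOf A T) (x : X) (t : ℝ) (ht : 0 ≤ t) :
    (∫ s in (0:ℝ)..t, T (max s 0) x, T t x - x) ∈ A.graph := by
  rw [dp_graph_iff hA]
  have hc := dp_ext_cont hT.strongCont
  have hci : ∀ a b, IntervalIntegrable (fun s => T (max s 0) x) volume a b :=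
    fun a b => (hc x).intervalIntegrable a b
  have h1 := dp_prim_tendsto _ (hc x)
  have h2 := dp_prim_tendsto (fun s => T (max (s + t) 0) x)
    ((hc x).comp (by fun_prop : Continuous fun s : ℝ => s + t))
  have h3 := h2.sub h1
  simp only [zero_add, max_self, max_eq_left ht, hT.map_zero, ContinuousLinearMap.id_apply] at h3
  refine h3.congr' ?_
  filter_upwards [self_mem_nhdsWithin] with h hh
  have hh0 : 0 ≤ h := le_of_lt hh
  rw [← smul_sub]
  congr 1
  rw [← ContinuousLinearMap.intervalIntegral_comp_comm _ (hci _ _)]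
  have h4 : (∫ s in (0:ℝ)..t, T h (T (max s 0) x)) = ∫ s in (0:ℝ)..t, T (max (s + h) 0) x := by
    refine dp_congr ht (fun s hs _ => ?_)
    rw [max_eq_left hs, max_eq_left (by linarith), add_comm s h, hT.map_add h s hh0 hs]; rfl
  rw [h4, intervalIntegral.integral_comp_add_right (fun s => T (max s 0) x) h,
    intervalIntegral.integral_comp_add_right (fun s => T (max s 0) x) t, zero_add, zero_add]
  rw [add_comm h t]
  have h5 := intervalIntegral.integral_add_adjacent_intervals (hci 0 t) (hci t (t+h))
  have h6 := intervalIntegral.integral_add_adjacent_intervals (hci 0 h) (hci h (t+h))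
  rw [sub_eq_sub_iff_add_eq_add, add_comm, h5, ← h6]
  exact add_comm _ _

theorem dp_sg_dense {A : X →ₗ.[ℝ] X} {T : ℝ → X →L[ℝ] X} (hT : IsC0Semigroup T)
    (hA : IsGeneratorOf A T) : Dense (range (fun γ : A.graph => γ.1.1)) := by
  intro x
  have h1 := dp_prim_tendsto _ (dp_ext_cont hT.strongCont x)
  simp only [max_self, hT.map_zero, ContinuousLinearMap.id_apply] at h1
  refine mem_closure_of_tendsto h1 ?_
  filter_upwards [self_mem_nhdsWithin] with t ht
  exact ⟨t⁻¹ • ⟨_, dp_sg_int_mem hT hA x t (le_of_lt ht)⟩, rfl⟩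

theorem dp_J0 {A : X →ₗ.[ℝ] X} {T : ℝ → X →L[ℝ] X} (hT : IsC0Semigroup T)
    (hA : IsGeneratorOf A T) :
    ∃ J0 : ℝ → X →L[ℝ] A.graph, (∀ x, Continuous (fun t => J0 t x)) ∧
    (∀ t, 0 ≤ t → ∀ x, (J0 t x).1.1 = ∫ s in (0:ℝ)..t, T (max s 0) x) ∧
    (∀ t, 0 ≤ t → ∀ x, (J0 t x).1.2 = T (max t 0) x - x) := by
  have hc := dp_ext_cont hT.strongCont
  choose I hI using dp_int_clm (fun t => T (max t 0)) hc
  let P : ℝ → X →L[ℝ] X × X := fun t => (I t).prod (T (max t 0) - ContinuousLinearMap.id ℝ X)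
  have hP : ∀ t, 0 ≤ t → ∀ x, P t x ∈ A.graph := by
    intro t ht x
    have := dp_sg_int_mem hT hA x t ht
    simpa [P, hI, max_eq_left ht] using this
  refine ⟨fun t => (P (max t 0)).codRestrict A.graph (hP _ (le_max_right _ _)), ?_, ?_, ?_⟩
  · intro x
    refine Continuous.subtype_mk (f := fun t => P (max t 0) x) ?_ _
    refine Continuous.comp (g := fun t => P t x) ?_ (by fun_prop)
    have : (fun t => P t x) = fun t => (∫ s in (0:ℝ)..t, T (max s 0) x, T (max t 0) x - x) := by
      ext t
      · simp [P, hI]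
      · simp [P]
    rw [this]
    exact (intervalIntegral.continuous_primitive
      (fun a c => (hc x).intervalIntegrable a c) 0).prodMk ((hc x).sub continuous_const)
  · intro t ht x
    simp [P, hI, max_eq_left ht]
  · intro t ht x
    simp [P]

end DPSemigroup

section DPFinal

theorem dp_graph_val {A : X →ₗ.[ℝ] X} (γ : A.graph) {x : X} (hx : x ∈ A.domain)
    (h : γ.1.1 = x) : A ⟨x, hx⟩ = γ.1.2 := by
  obtain ⟨y, hy1, hy2⟩ := LinearPMap.mem_graph_iff A |>.1 γ.2
  rw [← hy2]
  congr 1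
  exact Subtype.ext (h.symm.trans hy1.symm)

theorem dp_graph_dom {A : X →ₗ.[ℝ] X} (γ : A.graph) : γ.1.1 ∈ A.domain := by
  obtain ⟨y, hy1, hy2⟩ := LinearPMap.mem_graph_iff A |>.1 γ.2
  rw [← hy1]; exact y.2

theorem dp_b {U V : ℝ → X →L[ℝ] X} (hU : IsC0Semigroup U) (hV : IsC0Semigroup V)
    {A G : X →ₗ.[ℝ] X} (hA : IsGeneratorOf A U) (hG : IsGeneratorOf G V) (B : A.domain →ₗ[ℝ] X)
    (hGext : ∀ u : A.domain, ∃ h : (u : X) ∈ G.domain, G ⟨(u : X), h⟩ = A u + B u) :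
    ∃ b : A.graph →L[ℝ] X, (∀ (γ : A.graph) (x : X) (h : x ∈ A.domain), γ.1.1 = x → b γ = B ⟨x, h⟩) ∧
      ∀ γ : A.graph, (γ.1.1, γ.1.2 + b γ) ∈ G.graph := by
  have : CompleteSpace A.graph := (dp_sg_closed hU hA).completeSpace_coe
  let b0 : A.graph →ₗ[ℝ] X :=
    { toFun := fun γ => B ⟨γ.1.1, dp_graph_dom γ⟩
      map_add' := fun γ γ' => by rw [← map_add]; rfl
      map_smul' := fun c γ => by rw [← map_smul]; rfl }
  have hmem : ∀ γ : A.graph, (γ.1.1, γ.1.2 + b0 γ) ∈ G.graph := by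
    intro γ
    obtain ⟨h, h2⟩ := hGext ⟨γ.1.1, dp_graph_dom γ⟩
    rw [LinearPMap.mem_graph_iff]
    refine ⟨⟨γ.1.1, h⟩, rfl, ?_⟩
    rw [h2, dp_graph_val γ _ rfl]
    rfl
  have hcont : Continuous b0 := by
    refine b0.continuous_of_seq_closed_graph fun u x y hu hy => ?_
    have h1 : Tendsto (fun n => ((u n).1.1, (u n).1.2 + b0 (u n))) atTop (𝓝 (x.1.1, x.1.2 + y)) := by
      have h11 := ((dpFst A.graph).continuous.tendsto x).comp hu
      have h12 := ((dpSnd A.graph).continuous.tendsto x).comp hu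
      exact h11.prodMk_nhds (h12.add hy)
    have h2 : (x.1.1, x.1.2 + y) ∈ G.graph :=
      (dp_sg_closed hV hG).mem_of_tendsto h1 (Eventually.of_forall fun n => hmem (u n))
    have h3 := tendsto_nhds_unique ((dp_graph_iff hG _ _).1 h2) ((dp_graph_iff hG _ _).1 (hmem x))
    exact add_left_cancel h3
  refine ⟨⟨b0, hcont⟩, ?_, hmem⟩
  rintro γ x h rfl
  rfl

theorem dp_cone_int {C : Set X} (hC : Convex ℝ C) (h0 : (0 : X) ∈ C)
    (hs : ∀ c : ℝ, 0 ≤ c → ∀ u ∈ C, c • u ∈ C)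
    (w : ℝ → X) (hw : Continuous w) (hwC : ∀ s, 0 ≤ s → w s ∈ C) (t : ℝ) (ht : 0 ≤ t) :
    (∫ s in (0:ℝ)..t, w s) ∈ closure C := by
  rcases ht.eq_or_lt with rfl | ht'
  · simpa using subset_closure h0
  have h1 : (⨍ s in Ioc 0 t, w s) ∈ closure C := by
    apply hC.set_average_mem_closure
    · simp [ht']
    · simp
    · filter_upwards [ae_restrict_mem measurableSet_Ioc] with s hs using hwC s hs.1.le
    · exact (hw.integrableOn_Icc (a := 0) (b := t)).mono_set Ioc_subset_Icc_self
  have h2 : (∫ s in (0:ℝ)..t, w s) = t • ⨍ s in Ioc 0 t, w s := by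
    rw [setAverage_eq, intervalIntegral.integral_of_le ht]
    simp [measureReal_def, ht, smul_smul, ht'.ne']
  rw [h2]
  exact map_mem_closure (continuous_const_smul t) h1 (fun u hu => hs t ht u hu)

end DPFinal

/-- Fine properties of the Dyson–Phillips iterates `Vₙ`: differentiability on `D(A)`,
invariance of `D(A)`, the identities for `A Vₙ(t)u` and `A ∫₀ᵗ Vₙ(s)u ds`, and graph-norm
convergence of the Laplace-transform integrals `∫₀^∞ e^{-λs} Vₙ(s)u ds`. -/
theorem dyson_phillips_fine_properties
    (hconeadd : ∀ u v : X, 0 ≤ u → 0 ≤ v → 0 ≤ u + v)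
    (hconesmul : ∀ (c : ℝ) (u : X), 0 ≤ c → 0 ≤ u → 0 ≤ c • u)
    (hgen : ∀ u : X, ∃ v w : X, 0 ≤ v ∧ 0 ≤ w ∧ u = v - w)
    (haddnorm : ∀ u v : X, 0 ≤ u → 0 ≤ v → ‖u + v‖ = ‖u‖ + ‖v‖)
    (Ψ : X →L[ℝ] ℝ) (hΨ : ∀ u : X, 0 ≤ u → Ψ u = ‖u‖)
    (U : ℝ → X →L[ℝ] X) (hU : IsSubstochastic U)
    (A : X →ₗ.[ℝ] X) (hA : IsGeneratorOf A U)
    (B : A.domain →ₗ[ℝ] X)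
    (hBpos : ∀ u : A.domain, 0 ≤ (u : X) → 0 ≤ B u)
    (hdiss : ∀ u : A.domain, 0 ≤ (u : X) → Ψ (A u + B u) ≤ 0)
    -- the minimal substochastic semigroup V generated by an extension G of A + B
    (G : X →ₗ.[ℝ] X) (V : ℝ → X →L[ℝ] X)
    (hV : IsSubstochastic V) (hGV : IsGeneratorOf G V)
    (hGext : ∀ u : A.domain, ∃ h : (u : X) ∈ G.domain, G ⟨(u : X), h⟩ = A u + B u)
    -- U leaves D(A) invariant
    (hUdom : ∀ (s : ℝ), 0 ≤ s → ∀ u : A.domain, U s (u : X) ∈ A.domain)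
    -- the Dyson-Phillips iterates: V₀ = U, V_{n+1}(t)u = ∫₀ᵗ Vₙ(t-s) B U(s)u ds on D(A),
    -- each extended to a bounded positive operator on X
    (Vn : ℕ → ℝ → X →L[ℝ] X)
    (hVnpos : ∀ (n : ℕ) (t : ℝ), 0 ≤ t → ∀ u : X, 0 ≤ u → 0 ≤ Vn n t u)
    (hVncont : ∀ (n : ℕ) (u : X), ContinuousOn (fun t => Vn n t u) (Ici (0 : ℝ)))
    (hV0 : Vn 0 = U)
    (hVrec : ∀ (n : ℕ) (t : ℝ), 0 ≤ t → ∀ u : A.domain,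
      Vn (n + 1) t (u : X) =
        ∫ s in (0:ℝ)..t,
          Vn n (t - s) (B ⟨U (max s 0) (u : X), hUdom (max s 0) (le_max_right _ _) u⟩))
    :
    ∃ mem : ∀ (n : ℕ) (t : ℝ), 0 ≤ t → ∀ u : A.domain, Vn n t (u : X) ∈ A.domain,
    ∃ memInt : ∀ (n : ℕ) (t : ℝ), 0 ≤ t → ∀ u : X, (∫ s in (0:ℝ)..t, Vn n s u) ∈ A.domain,
    ∃ memLap : ∀ (n : ℕ) (l : ℝ), 0 < l → ∀ (t : ℝ), 0 ≤ t → ∀ u : X,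
        (∫ s in (0:ℝ)..t, Real.exp (-l * s) • Vn n s u) ∈ A.domain,
      -- (1) continuous differentiability on (0,∞) for u ∈ D(A)
      (∀ (n : ℕ) (u : A.domain),
        (∀ t : ℝ, 0 < t →
          HasDerivAt (fun r : ℝ => Vn (n + 1) r (u : X))
            (Vn (n + 1) t (A u) + Vn n t (B u)) t) ∧
        ContinuousOn (fun t : ℝ => Vn (n + 1) t (A u) + Vn n t (B u)) (Ioi (0 : ℝ))) ∧
      -- (2) A Vₙ(t)u = Vₙ(t)Au + V_{n-1}(t)Bu - B V_{n-1}(t)u on D(A)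
      (∀ (n : ℕ) (u : A.domain) (t : ℝ) (ht : 0 ≤ t),
        A ⟨Vn (n + 1) t (u : X), mem (n + 1) t ht u⟩ =
          Vn (n + 1) t (A u) + Vn n t (B u) - B ⟨Vn n t (u : X), mem n t ht u⟩) ∧
      -- (2') continuity of t ↦ A Vₙ(t)u
      (∀ (n : ℕ) (u : A.domain), ∃ g : ℝ → X, ContinuousOn g (Ici (0 : ℝ)) ∧
        ∀ (t : ℝ) (ht : 0 ≤ t), g t = A ⟨Vn (n + 1) t (u : X), mem (n + 1) t ht u⟩) ∧
      -- (3) A ∫₀ᵗ Vₙ(s)u ds = Vₙ(t)u - B ∫₀ᵗ V_{n-1}(s)u ds for all u ∈ X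
      (∀ (n : ℕ) (u : X) (t : ℝ) (ht : 0 ≤ t),
        A ⟨∫ s in (0:ℝ)..t, Vn (n + 1) s u, memInt (n + 1) t ht u⟩ =
          Vn (n + 1) t u - B ⟨∫ s in (0:ℝ)..t, Vn n s u, memInt n t ht u⟩) ∧
      -- (3') continuity of t ↦ A ∫₀ᵗ Vₙ(s)u ds
      (∀ (n : ℕ) (u : X), ∃ g : ℝ → X, ContinuousOn g (Ici (0 : ℝ)) ∧
        ∀ (t : ℝ) (ht : 0 ≤ t), g t = A ⟨∫ s in (0:ℝ)..t, Vn (n + 1) s u, memInt (n + 1) t ht u⟩) ∧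
      -- (4) the Laplace integrals converge in the graph norm of A and
      -- (λ-A)∫₀^∞ e^{-λs}Vₙ(s)u ds = B ∫₀^∞ e^{-λs}V_{n-1}(s)u ds
      (∀ (u : X) (l : ℝ) (hl : 0 < l), ∃ W : ℕ → X, ∃ hW : ∀ n : ℕ, W n ∈ A.domain,
        (∀ n : ℕ, Tendsto (fun t : ℝ => ∫ s in (0:ℝ)..t, Real.exp (-l * s) • Vn n s u)
          atTop (𝓝 (W n))) ∧
        (∀ n : ℕ, Tendsto (fun t : ℝ =>
            if ht : 0 ≤ t then
              A ⟨∫ s in (0:ℝ)..t, Real.exp (-l * s) • Vn n s u, memLap n l hl t ht u⟩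
            else 0)
          atTop (𝓝 (A ⟨W n, hW n⟩))) ∧
        (∀ n : ℕ, l • W (n + 1) - A ⟨W (n + 1), hW (n + 1)⟩ = B ⟨W n, hW n⟩)) := by
  have hUc := hU.1
  have hVc := hV.1
  have hΓ := dp_sg_closed hUc hA
  have : CompleteSpace A.graph := hΓ.completeSpace_coe
  have hdense := dp_sg_dense hUc hA
  have hinj : ∀ γ γ' : A.graph, γ.1.1 = γ'.1.1 → γ = γ' := by
    intro γ γ' h
    apply Subtype.ext
    refine Prod.ext h ?_
    rw [← dp_graph_val γ (dp_graph_dom γ) rfl, ← dp_graph_val γ' (dp_graph_dom γ) h.symm]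
  obtain ⟨b, hbB, hbG⟩ := dp_b hUc hVc hA hGV B hGext
  obtain ⟨J0, hJ0c, hJ0f, hJ0s⟩ := dp_J0 hUc hA
  set v : ℕ → ℝ → X →L[ℝ] X := fun n t => Vn n (max t 0) with hvdef
  have hvV : ∀ n t, 0 ≤ t → v n t = Vn n t := by
    intro n t ht; simp only [hvdef, max_eq_left ht]
  have hv : ∀ n x, Continuous (fun t => v n t x) := fun n x => dp_ext_cont (hVncont n) x
  have hvU : ∀ t, v 0 t = U (max t 0) := by intro t; simp only [hvdef, hV0]
  have hv0 : ∀ t, 0 ≤ t → ∀ γ : A.graph,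
      v 0 t γ.1.1 = γ.1.1 + ∫ s in (0:ℝ)..t, v 0 s γ.1.2 := by
    intro t ht γ
    simp only [hvU]
    rw [← dp_sg_int hUc hA γ.2 t ht, max_eq_left ht]; abel
  have hJ0f' : ∀ t, 0 ≤ t → ∀ x, (J0 t x).1.1 = ∫ s in (0:ℝ)..t, v 0 s x := by
    simp only [hvU]; exact hJ0f
  have hJ0s' : ∀ t, 0 ≤ t → ∀ x, (J0 t x).1.2 = v 0 t x - x := by
    simp only [hvU]; exact hJ0s
  have hrec : ∀ n t, 0 ≤ t → ∀ γ : A.graph,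
      v (n + 1) t γ.1.1 = ∫ s in (0:ℝ)..t, v n (t - s) (b (γ + J0 s γ.1.2)) := by
    intro n t ht γ
    rw [hvV _ _ ht]
    rw [hVrec n t ht ⟨γ.1.1, dp_graph_dom γ⟩]
    refine dp_congr ht (fun s hs hst => ?_)
    rw [hvV n (t - s) (by linarith)]
    congr 1
    symm
    apply hbB
    show γ.1.1 + (J0 s γ.1.2).1.1 = U (max s 0) γ.1.1
    rw [hJ0f' s hs, ← hv0 s hs, hvU]
  obtain ⟨J, hJ00, hJc, hJf, hJs, hstar⟩ := dp_core A.graph hΓ hinj hdense b J0 hJ0c v hv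
    hJ0f' hJ0s' hv0 hrec
  rw [← hJ00] at hJ0s'
  -- the elements `V_n(t)u` of the graph
  obtain ⟨Zc, hZ0, hZ1⟩ : ∃ Zc : ℕ → ℝ → A.graph → A.graph,
      (∀ t γ, Zc 0 t γ = γ + J 0 t γ.1.2) ∧
      (∀ n t γ, Zc (n + 1) t γ = J n t (b γ) + J (n + 1) t γ.1.2) :=
    ⟨fun n t γ => Nat.casesOn n (γ + J 0 t γ.1.2) (fun n => J n t (b γ) + J (n + 1) t γ.1.2),
      fun _ _ => rfl, fun _ _ _ => rfl⟩
  have hZf : ∀ n t, 0 ≤ t → ∀ γ, (Zc n t γ).1.1 = v n t γ.1.1 := by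
    intro n t ht γ
    cases n with
    | zero =>
      rw [hZ0]
      show γ.1.1 + (J 0 t γ.1.2).1.1 = _
      rw [hJf 0 t ht, hv0 t ht]
    | succ n =>
      rw [hZ1]
      show (J n t (b γ)).1.1 + (J (n + 1) t γ.1.2).1.1 = _
      rw [hJf n t ht, hJf (n + 1) t ht, hstar n t ht]
  have hZc : ∀ n γ, Continuous (fun t => Zc n t γ) := by
    intro n γ
    cases n with
    | zero => simp only [hZ0]; exact continuous_const.add (hJc 0 _)
    | succ n => simp only [hZ1]; exact (hJc _ _).add (hJc _ _)
  have hZs : ∀ n t, 0 ≤ t → ∀ γ, (Zc (n + 1) t γ).1.2 =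
      v (n + 1) t γ.1.2 + v n t (b γ) - b (Zc n t γ) := by
    intro n t ht γ
    rw [hZ1]
    show (J n t (b γ)).1.2 + (J (n + 1) t γ.1.2).1.2 = _
    rw [hJs n t ht]
    cases n with
    | zero => rw [hJ0s' t ht, hZ0, map_add]; abel
    | succ n => rw [hJs n t ht, hZ1, map_add]; abel
  -- the positive cone
  have hCconv : Convex ℝ {u : X | 0 ≤ u} := by
    intro x hx y hy p q hp hq _
    exact hconeadd _ _ (hconesmul _ _ hp hx) (hconesmul _ _ hq hy)
  have hCadd : ∀ x ∈ closure {u : X | 0 ≤ u}, ∀ y ∈ closure {u : X | 0 ≤ u},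
      x + y ∈ closure {u : X | 0 ≤ u} := fun x hx y hy =>
    map_mem_closure₂ continuous_add hx hy (fun a ha c hc => hconeadd a c ha hc)
  have hvpos : ∀ n t, ∀ u : X, 0 ≤ u → 0 ≤ v n t u := fun n t u hu =>
    hVnpos n _ (le_max_right _ _) u hu
  have hJC : ∀ n t, 0 ≤ t → ∀ u : X, 0 ≤ u → (J n t u).1.1 ∈ closure {u : X | 0 ≤ u} := by
    intro n t ht u hu
    rw [hJf n t ht]
    exact dp_cone_int hCconv (le_refl (0 : X)) (fun c hc u hu => hconesmul c u hc hu) _ (hv n u)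
      (fun s _ => hvpos n s u hu) t ht
  have hΨC : ∀ u ∈ closure {u : X | 0 ≤ u}, 0 ≤ Ψ u := by
    have hcl : IsClosed {u : X | 0 ≤ Ψ u} := isClosed_le continuous_const Ψ.continuous
    refine fun u hu => closure_minimal (fun u hu => ?_) hcl hu
    show 0 ≤ Ψ u
    rw [hΨ u hu]; exact norm_nonneg _
  have hF1 : ∀ γ : A.graph, γ.1.1 ∈ closure {u : X | 0 ≤ u} → Ψ (γ.1.2 + b γ) ≤ 0 := by
    intro γ hγ
    have h1 := (Ψ.continuous.tendsto _).comp ((dp_graph_iff hGV _ _).1 (hbG γ))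
    refine le_of_tendsto h1 ?_
    filter_upwards [self_mem_nhdsWithin] with t ht
    have ht0 : (0:ℝ) < t := ht
    have hcl : IsClosed {u : X | Ψ (V t u) ≤ Ψ u} := isClosed_le (by fun_prop) Ψ.continuous
    have h2 : Ψ (V t γ.1.1) ≤ Ψ γ.1.1 := by
      refine closure_minimal (fun u hu => ?_) hcl hγ
      have h3 := hV.2 t ht0.le u hu
      show Ψ (V t u) ≤ Ψ u
      rw [hΨ _ h3.1, hΨ u hu]; exact h3.2
    simp only [Function.comp_apply, map_smul, map_sub, smul_eq_mul]
    exact mul_nonpos_of_nonneg_of_nonpos (by positivity) (by linarith)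
  have hv10 : ∀ x, v 1 0 x = 0 := by
    have : (v 1 0 : X → X) = fun _ => 0 := by
      refine Continuous.ext_on hdense (v 1 0).continuous continuous_const ?_
      rintro _ ⟨γ, rfl⟩
      simpa using hstar 0 0 le_rfl γ
    intro x; rw [this]
  have hstar' : ∀ n t, 0 ≤ t → ∀ γ : A.graph, v (n + 1) t γ.1.1 =
      ∫ s in (0:ℝ)..t, (v (n + 1) s γ.1.2 + v n s (b γ)) := by
    intro n t ht γ
    rw [hstar n t ht, intervalIntegral.integral_add ((hv _ _).intervalIntegrable _ _)
      ((hv _ _).intervalIntegrable _ _), add_comm]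
  have hF2 : ∀ γ : A.graph, γ.1.1 ∈ closure {u : X | 0 ≤ u} → 0 ≤ Ψ (b γ) := by
    intro γ hγ
    have h1 := dp_prim_tendsto (fun s => v 1 s γ.1.2 + v 0 s (b γ)) ((hv _ _).add (hv _ _))
    simp only [hv10, zero_add, hvU, max_self, hUc.map_zero, ContinuousLinearMap.id_apply] at h1
    refine ge_of_tendsto ((Ψ.continuous.tendsto _).comp h1) ?_
    filter_upwards [self_mem_nhdsWithin] with t ht
    have ht0 : (0:ℝ) < t := ht
    have h2 := hstar' 0 t ht0.le γ
    simp only [zero_add, hvU] at h2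
    simp only [Function.comp_apply]
    rw [← h2, map_smul, smul_eq_mul]
    refine mul_nonneg (by positivity) (hΨC _ ?_)
    exact map_mem_closure (v 1 t).continuous hγ (fun u hu => hvpos 1 t u hu)
  have hF3 : ∀ n t, 0 ≤ t → ∀ u : X, 0 ≤ u → ‖v n t u‖ ≤ ‖u‖ := by
    intro n t ht u hu
    have e1 : ∀ n, (∑ k ∈ Finset.range (n + 1), J k t u).1.2 +
        b (∑ k ∈ Finset.range (n + 1), J k t u) =
        (∑ k ∈ Finset.range (n + 1), v k t u) - u + b (J n t u) := by
      intro n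
      induction n with
      | zero => simp only [zero_add, Finset.sum_range_one]; rw [hJ0s' t ht]
      | succ n ih =>
        rw [Finset.sum_range_succ, Finset.sum_range_succ (fun k => v k t u), map_add]
        have : ((∑ k ∈ Finset.range (n + 1), J k t u) + J (n + 1) t u).1.2 =
          (∑ k ∈ Finset.range (n + 1), J k t u).1.2 + (J (n + 1) t u).1.2 := rfl
        rw [this, hJs n t ht]
        have e2 := eq_sub_of_add_eq ih
        rw [e2]; abel
    have e3 : ∀ n, (∑ k ∈ Finset.range (n + 1), J k t u).1.1 ∈ closure {u : X | 0 ≤ u} := by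
      intro n
      induction n with
      | zero => simp only [zero_add, Finset.sum_range_one]; exact hJC 0 t ht u hu
      | succ n ih =>
        rw [Finset.sum_range_succ]
        exact hCadd _ ih _ (hJC _ t ht u hu)
    have e4 := hF1 _ (e3 n)
    rw [e1 n, map_add, map_sub, map_sum] at e4
    have e5 := hF2 _ (hJC n t ht u hu)
    have e6 : Ψ (v n t u) ≤ ∑ k ∈ Finset.range (n + 1), Ψ (v k t u) := by
      refine Finset.single_le_sum (f := fun k => Ψ (v k t u)) (fun k _ => ?_) (by simp)
      exact hΨC _ (subset_closure (hvpos k t u hu))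
    rw [← hΨ u hu, ← hΨ _ (hvpos n t u hu)]
    linarith
  have hF4 : ∀ u : X, ∃ M, ∀ n t, 0 ≤ t → ‖v n t u‖ ≤ M := by
    intro u
    obtain ⟨p, q, hp, hq, rfl⟩ := hgen u
    refine ⟨‖p‖ + ‖q‖, fun n t ht => ?_⟩
    rw [map_sub]
    exact (norm_sub_le _ _).trans (add_le_add (hF3 n t ht p hp) (hF3 n t ht q hq))
  have hF5 : ∀ (u : X) (n : ℕ), ∃ c, ∀ t, 0 ≤ t → ‖J n t u‖ ≤ c * (1 + t) := by
    intro u n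
    obtain ⟨M, hM⟩ := hF4 u
    have hM0 : 0 ≤ M := (norm_nonneg _).trans (hM 0 0 le_rfl)
    have hfst : ∀ n t, 0 ≤ t → ‖(J n t u).1.1‖ ≤ M * t := by
      intro n t ht
      rw [hJf n t ht]
      have := intervalIntegral.norm_integral_le_of_norm_le_const (a := 0) (b := t) (C := M)
        (f := fun s => v n s u) (fun s hs => hM n s (by
          rw [uIoc_of_le ht] at hs; exact hs.1.le))
      simpa [abs_of_nonneg ht] using this
    induction n with
    | zero =>
      refine ⟨M + ‖u‖, fun t ht => ?_⟩
      have h1 := hfst 0 t ht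
      have h2 : ‖(J 0 t u).1.2‖ ≤ M + ‖u‖ := by
        rw [hJ0s' t ht]
        exact (norm_sub_le _ _).trans (add_le_add (hM 0 t ht) le_rfl)
      have h3 : 0 ≤ ‖u‖ := norm_nonneg _
      show ‖(J 0 t u).1‖ ≤ _
      rw [Prod.norm_def]
      refine max_le ?_ ?_ <;> nlinarith
    | succ n ih =>
      obtain ⟨c, hc⟩ := ih
      have hc0 : 0 ≤ c := by
        have := (norm_nonneg _).trans (hc 0 le_rfl); simpa using this
      refine ⟨M + ‖b‖ * c, fun t ht => ?_⟩
      have h1 := hfst (n + 1) t ht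
      have h2 : ‖(J (n + 1) t u).1.2‖ ≤ M + ‖b‖ * (c * (1 + t)) := by
        rw [hJs n t ht]
        exact (norm_sub_le _ _).trans (add_le_add (hM _ t ht)
          ((b.le_opNorm _).trans (mul_le_mul_of_nonneg_left (hc t ht) (norm_nonneg _))))
      have h3 : 0 ≤ ‖b‖ * c := mul_nonneg b.opNorm_nonneg hc0
      show ‖(J (n + 1) t u).1‖ ≤ _
      rw [Prod.norm_def]
      refine max_le ?_ ?_ <;> nlinarith
  -- Laplace transforms in the graph
  obtain ⟨L, hL⟩ : ∃ L : ℝ → X → ℕ → ℝ → A.graph, ∀ l u n t, L l u n t =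
      Real.exp (-l * t) • J n t u + l • ∫ s in (0:ℝ)..t, Real.exp (-l * s) • J n s u :=
    ⟨_, fun _ _ _ _ => rfl⟩
  have hJe : ∀ l u n, Continuous (fun s : ℝ => Real.exp (-l * s) • J n s u) := by
    intro l u n
    exact (by fun_prop : Continuous fun s : ℝ => Real.exp (-l * s)).smul (hJc n u)
  have hve : ∀ l u n, Continuous (fun s : ℝ => Real.exp (-l * s) • v n s u) := by
    intro l u n
    exact (by fun_prop : Continuous fun s : ℝ => Real.exp (-l * s)).smul (hv n u)
  have hLf' : ∀ l u n t, 0 ≤ t → dpFst A.graph (L l u n t) =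
      ∫ s in (0:ℝ)..t, Real.exp (-l * s) • v n s u := by
    intro l u n t ht
    rw [hL, dp_lap_parts _ (hv n u), map_add, map_smul, map_smul,
      ← ContinuousLinearMap.intervalIntegral_comp_comm _ ((hJe l u n).intervalIntegrable _ _),
      dpFst_apply, hJf n t ht]
    congr 2
    refine dp_congr ht (fun s hs _ => ?_)
    rw [map_smul, dpFst_apply, hJf n s hs]
  have hLf : ∀ l u n t, 0 ≤ t → (L l u n t).1.1 =
      ∫ s in (0:ℝ)..t, Real.exp (-l * s) • Vn n s u := by
    intro l u n t ht
    rw [← dpFst_apply, hLf' l u n t ht]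
    refine dp_congr ht (fun s hs _ => ?_)
    rw [hvV n s hs]
  have hLs : ∀ l u n t, 0 ≤ t → dpSnd A.graph (L l u (n + 1) t) =
      Real.exp (-l * t) • v (n + 1) t u + l • dpFst A.graph (L l u (n + 1) t) -
        b (L l u n t) := by
    intro l u n t ht
    rw [hLf' l u (n + 1) t ht, hL, hL, map_add, map_smul, map_smul, map_add, map_smul, map_smul,
      ← ContinuousLinearMap.intervalIntegral_comp_comm _ ((hJe l u _).intervalIntegrable _ _),
      ← ContinuousLinearMap.intervalIntegral_comp_comm _ ((hJe l u _).intervalIntegrable _ _),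
      dpSnd_apply, hJs n t ht]
    have e1 : (∫ s in (0:ℝ)..t, dpSnd A.graph (Real.exp (-l * s) • J (n + 1) s u)) =
        (∫ s in (0:ℝ)..t, Real.exp (-l * s) • v (n + 1) s u) -
          ∫ s in (0:ℝ)..t, b (Real.exp (-l * s) • J n s u) := by
      rw [← intervalIntegral.integral_sub ((hve l u _).intervalIntegrable _ _)
        ((show Continuous (fun s => b (Real.exp (-l * s) • J n s u)) from
          b.continuous.comp (hJe l u n)).intervalIntegrable _ _)]
      refine dp_congr ht (fun s hs _ => ?_)
      rw [map_smul, dpSnd_apply, hJs n s hs, smul_sub, map_smul]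
    rw [e1, smul_sub, smul_sub]
    abel
  have hIf : ∀ n t, 0 ≤ t → ∀ u, (J n t u).1.1 = ∫ s in (0:ℝ)..t, Vn n s u := by
    intro n t ht u
    rw [hJf n t ht]
    refine dp_congr ht (fun s hs _ => ?_)
    rw [hvV n s hs]
  obtain ⟨gr, hgr1, hgr2⟩ : ∃ gr : A.domain → A.graph, (∀ u, (gr u).1.1 = (u : X)) ∧
      ∀ u, (gr u).1.2 = A u :=
    ⟨fun u => ⟨((u : X), A u), LinearPMap.mem_graph A u⟩, fun _ => rfl, fun _ => rfl⟩
  have hgrb : ∀ u, b (gr u) = B u := fun u => hbB (gr u) u u.2 (hgr1 u)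
  have hZf' : ∀ n t, 0 ≤ t → ∀ u : A.domain, (Zc n t (gr u)).1.1 = Vn n t (u : X) := by
    intro n t ht u
    rw [hZf n t ht, hgr1, hvV n t ht]
  have mem : ∀ (n : ℕ) (t : ℝ), 0 ≤ t → ∀ u : A.domain, Vn n t (u : X) ∈ A.domain := by
    intro n t ht u
    rw [← hZf' n t ht u]; exact dp_graph_dom _
  have memInt : ∀ (n : ℕ) (t : ℝ), 0 ≤ t → ∀ u : X, (∫ s in (0:ℝ)..t, Vn n s u) ∈ A.domain := by
    intro n t ht u
    rw [← hIf n t ht u]; exact dp_graph_dom _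
  have memLap : ∀ (n : ℕ) (l : ℝ), 0 < l → ∀ (t : ℝ), 0 ≤ t → ∀ u : X,
        (∫ s in (0:ℝ)..t, Real.exp (-l * s) • Vn n s u) ∈ A.domain := by
    intro n l _ t ht u
    rw [← hLf l u n t ht]; exact dp_graph_dom _
  refine ⟨mem, memInt, memLap, ?_, ?_, ?_, ?_, ?_, ?_⟩
  · intro n u
    constructor
    · intro t ht
      have hc : Continuous (fun s => v (n + 1) s (gr u).1.2 + v n s (b (gr u))) :=
        (hv _ _).add (hv _ _)
      have h2 : HasDerivAt (fun r => ∫ s in (0:ℝ)..r, (v (n + 1) s (gr u).1.2 + v n s (b (gr u))))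
          (v (n + 1) t (gr u).1.2 + v n t (b (gr u))) t :=
        intervalIntegral.integral_hasDerivAt_right (hc.intervalIntegrable _ _)
          (hc.stronglyMeasurableAtFilter _ _) hc.continuousAt
      rw [hgr2, hgrb, hvV _ t ht.le, hvV _ t ht.le] at h2
      refine h2.congr_of_eventuallyEq ?_
      filter_upwards [lt_mem_nhds ht] with r hr
      rw [← hgr2, ← hgrb, ← hstar' n r hr.le, hgr1, hvV _ r hr.le]
    · exact ((hVncont _ _).add (hVncont _ _)).mono Ioi_subset_Ici_self
  · intro n u t ht
    rw [dp_graph_val (Zc (n + 1) t (gr u)) _ (hZf' _ t ht u), hZs n t ht, hgr2, hgrb,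
      hbB (Zc n t (gr u)) _ (mem n t ht u) (hZf' n t ht u), hvV _ t ht, hvV _ t ht]
  · intro n u
    refine ⟨fun t => dpSnd A.graph (Zc (n + 1) t (gr u)),
      ((dpSnd A.graph).continuous.comp (hZc _ _)).continuousOn, fun t ht => ?_⟩
    rw [dp_graph_val (Zc (n + 1) t (gr u)) _ (hZf' _ t ht u)]; rfl
  · intro n u t ht
    rw [dp_graph_val (J (n + 1) t u) _ (hIf _ t ht u), hJs n t ht, hvV _ t ht,
      hbB (J n t u) _ (memInt n t ht u) (hIf n t ht u)]
  · intro n u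
    refine ⟨fun t => dpSnd A.graph (J (n + 1) t u),
      ((dpSnd A.graph).continuous.comp (hJc _ _)).continuousOn, fun t ht => ?_⟩
    rw [dp_graph_val (J (n + 1) t u) _ (hIf _ t ht u)]; rfl
  · intro u l hl
    have hlim : ∀ n, ∃ Λ : A.graph, Tendsto (fun t => L l u n t) atTop (𝓝 Λ) := by
      intro n
      obtain ⟨c, hc⟩ := hF5 u n
      obtain ⟨Λ, hΛ⟩ := (dp_lap_tendsto (fun t => J n t u) (hJc n u) c l hl hc).2
      refine ⟨Λ, ?_⟩
      simp only [hL]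
      exact hΛ
    choose Λ hΛ using hlim
    have hΛf := fun n => ((dpFst A.graph).continuous.tendsto _).comp (hΛ n)
    have hΛs := fun n => ((dpSnd A.graph).continuous.tendsto _).comp (hΛ n)
    refine ⟨fun n => (Λ n).1.1, fun n => dp_graph_dom (Λ n), ?_, ?_, ?_⟩
    · intro n
      refine (hΛf n).congr' ?_
      filter_upwards [eventually_ge_atTop 0] with t ht
      exact hLf l u n t ht
    · intro n
      rw [dp_graph_val (Λ n) _ rfl]
      refine (hΛs n).congr' ?_
      filter_upwards [eventually_ge_atTop 0] with t ht
      rw [dif_pos ht, dp_graph_val (L l u n t) _ (hLf l u n t ht)]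
      rfl
    · intro n
      rw [dp_graph_val (Λ (n + 1)) _ rfl, ← hbB (Λ n) _ (dp_graph_dom (Λ n)) rfl]
      obtain ⟨M, hM⟩ := hF4 u
      have hM0 : 0 ≤ M := (norm_nonneg _).trans (hM 0 0 le_rfl)
      have hz := (dp_lap_tendsto (fun t => v (n + 1) t u) (hv _ u) M l hl
        (fun t ht => (hM _ t ht).trans (by nlinarith))).1
      have h1 := (hz.add ((hΛf (n + 1)).const_smul l)).sub ((b.continuous.tendsto _).comp (hΛ n))
      have h2 : Tendsto (fun t => dpSnd A.graph (L l u (n + 1) t)) atTop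
          (𝓝 (0 + l • dpFst A.graph (Λ (n + 1)) - b (Λ n))) := by
        refine h1.congr' ?_
        filter_upwards [eventually_ge_atTop 0] with t ht
        rw [hLs l u n t ht]
        rfl
      have h3 := tendsto_nhds_unique (hΛs (n + 1)) h2
      rw [dpSnd_apply, dpFst_apply, zero_add] at h3
      rw [h3]; abel
end
end

section
/- For every λ > 0 and every u ∈ X, lim_{t→∞} sup_{n∈ℕ} ‖B ∫_t^∞ e^{−λs} V_n(s)u ds‖ = 0. -/
open Filter Topology Set MeasureTheory

noncomputable section

variable {X : Type*} [NormedAddCommGroup X] [NormedSpace ℝ X] [CompleteSpace X] [PartialOrder X]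

theorem aux_jointCont {F : ℝ → X →L[ℝ] X} (hF : ∀ u, Continuous fun t => F t u) :
    Continuous fun p : ℝ × X => F p.1 p.2 := by
  rw [continuous_iff_continuousAt]
  rintro ⟨t0, x0⟩
  obtain ⟨M, hM⟩ : ∃ M, ∀ i : Icc (t0 - 1) (t0 + 1), ‖F i‖ ≤ M := by
    apply banach_steinhaus
    intro x
    obtain ⟨C, hC⟩ := (isCompact_Icc (a := t0 - 1) (b := t0 + 1)).exists_bound_of_continuousOn
      (hF x).continuousOn
    exact ⟨C, fun i => hC i i.2⟩
  rw [ContinuousAt, tendsto_iff_norm_sub_tendsto_zero]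
  have h1 : Tendsto (fun p : ℝ × X => M * ‖p.2 - x0‖ + ‖F p.1 x0 - F t0 x0‖) (𝓝 (t0, x0))
      (𝓝 (M * ‖x0 - x0‖ + ‖F t0 x0 - F t0 x0‖)) := by
    have : Continuous (fun p : ℝ × X => M * ‖p.2 - x0‖ + ‖F p.1 x0 - F t0 x0‖) := by
      have := (hF x0).comp (continuous_fst (X := ℝ) (Y := X))
      simp only [Function.comp_def] at this
      fun_prop
    exact this.tendsto (t0, x0)
  simp only [sub_self, norm_zero, mul_zero, add_zero] at h1
  refine squeeze_zero' (Eventually.of_forall fun _ => norm_nonneg _) ?_ h1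
  have hn : ∀ᶠ p : ℝ × X in 𝓝 (t0, x0), p.1 ∈ Icc (t0 - 1) (t0 + 1) :=
    (continuous_fst.tendsto (t0, x0)).eventually
      (Icc_mem_nhds (by simp) (by simp))
  filter_upwards [hn] with p hp
  have : F p.1 p.2 - F t0 x0 = F p.1 (p.2 - x0) + (F p.1 x0 - F t0 x0) := by
    rw [map_sub]; abel
  rw [this]
  refine (norm_add_le _ _).trans ?_
  gcongr
  exact (F p.1).le_of_opNorm_le (hM ⟨p.1, hp⟩) _

theorem aux_cont {Y : Type*} [TopologicalSpace Y] {F : ℝ → X →L[ℝ] X}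
    (hF : ∀ u, Continuous fun t => F t u)
    {a : Y → ℝ} {g : Y → X} (ha : Continuous a) (hg : Continuous g) :
    Continuous fun y => F (a y) (g y) :=
  (aux_jointCont hF).comp (ha.prodMk hg)

theorem aux_triangle {h : ℝ → ℝ → X} (hh : Continuous h.uncurry) {t : ℝ} (ht : 0 ≤ t) :
    ∫ τ in (0:ℝ)..t, ∫ s in (0:ℝ)..τ, h τ s = ∫ s in (0:ℝ)..t, ∫ τ in s..t, h τ s := by
  have e1 : ∫ τ in (0:ℝ)..t, ∫ s in (0:ℝ)..τ, h τ s =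
      ∫ τ in (0:ℝ)..t, ∫ s in (0:ℝ)..t, ({p : ℝ × ℝ | p.2 ≤ p.1}.indicator h.uncurry (τ, s)) := by
    apply intervalIntegral.integral_congr
    intro τ hτ
    rw [uIcc_of_le ht] at hτ
    simp only
    rw [← intervalIntegral.integral_indicator hτ]
    rfl
  have e2 : ∫ s in (0:ℝ)..t, ∫ τ in s..t, h τ s =
      ∫ s in (0:ℝ)..t, ∫ τ in (0:ℝ)..t, ({p : ℝ × ℝ | p.2 ≤ p.1}.indicator h.uncurry (τ, s)) := by
    apply intervalIntegral.integral_congr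
    intro s hs
    rw [uIcc_of_le ht] at hs
    simp only
    have : (fun τ => {p : ℝ × ℝ | p.2 ≤ p.1}.indicator h.uncurry (τ, s)) =
      (Ici s).indicator (fun τ => h τ s) := by
      ext τ
      simp [indicator, Function.uncurry]
    rw [this, intervalIntegral.integral_of_le ht, intervalIntegral.integral_of_le hs.2,
      ← integral_Icc_eq_integral_Ioc, ← integral_Icc_eq_integral_Ioc,
      setIntegral_indicator measurableSet_Ici]
    congr 2
    ext x
    simp only [mem_Icc, mem_inter_iff, mem_Ici]
    constructor
    · rintro ⟨a, b⟩; exact ⟨⟨hs.1.trans a, b⟩, a⟩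
    · rintro ⟨⟨a, b⟩, c⟩; exact ⟨c, b⟩
  rw [e1, e2]
  apply intervalIntegral_intervalIntegral_swap
  have : (Function.uncurry fun τ s => {p : ℝ × ℝ | p.2 ≤ p.1}.indicator h.uncurry (τ, s))
     = {p : ℝ × ℝ | p.2 ≤ p.1}.indicator h.uncurry := by ext ⟨a, b⟩; rfl
  rw [this]
  apply IntegrableOn.indicator
  · rw [uIoc_of_le ht]
    refine IntegrableOn.mono_set ?_ (prod_mono Ioc_subset_Icc_self Ioc_subset_Icc_self)
    exact hh.continuousOn.integrableOn_compact (isCompact_Icc.prod isCompact_Icc)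
  · exact (isClosed_le continuous_snd continuous_fst).measurableSet

/-- truncated Laplace integral -/
def auxZ (l : ℝ) (F : ℝ → X →L[ℝ] X) (t : ℝ) (u : X) : X :=
  ∫ s in (0:ℝ)..t, Real.exp (-l * s) • F s u

theorem auxZ_cont (l : ℝ) {F : ℝ → X →L[ℝ] X} (hF : ∀ u, Continuous fun t => F t u) (t : ℝ) :
    Continuous (auxZ l F t) := by
  unfold auxZ
  apply intervalIntegral.continuous_parametric_intervalIntegral_of_continuous'
  have := aux_cont hF (continuous_snd (X := X) (Y := ℝ)) continuous_fst
  show Continuous fun p : X × ℝ => Real.exp (-l * p.2) • F p.2 p.1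
  exact Continuous.smul (by fun_prop) this

theorem aux_cone_integral {K : Set X} (hKc : IsClosed K)
    (hKadd : ∀ u ∈ K, ∀ v ∈ K, u + v ∈ K) (hKsmul : ∀ c : ℝ, 0 ≤ c → ∀ u ∈ K, c • u ∈ K)
    {f : ℝ → X} (hf : Continuous f) {t : ℝ} (ht : 0 < t) (hfK : ∀ s, 0 ≤ s → f s ∈ K) :
    ∫ s in (0:ℝ)..t, f s ∈ K := by
  have hconv : Convex ℝ K := by
    intro x hx y hy a b ha hb _
    exact hKadd _ (hKsmul a ha x hx) _ (hKsmul b hb y hy)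
  have h1 : (⨍ x in (0:ℝ)..t, f x) ∈ K := by
    apply hconv.set_average_mem hKc
    · simp [uIoc_of_le ht.le, ht]
    · simp [uIoc_of_le ht.le]
    · rw [uIoc_of_le ht.le, ae_restrict_iff' measurableSet_Ioc]
      exact Eventually.of_forall fun s hs => hfK s hs.1.le
    · rw [uIoc_of_le ht.le]
      exact (hf.continuousOn.integrableOn_compact isCompact_Icc).mono_set Ioc_subset_Icc_self
  rw [interval_average_eq] at h1
  have := hKsmul t ht.le _ h1
  rwa [smul_smul, sub_zero, mul_inv_cancel₀ ht.ne', one_smul] at this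

theorem aux_clamp {f : ℝ → X} (hf : ContinuousOn f (Ici (0:ℝ))) :
    Continuous fun t => f (max t 0) :=
  hf.comp_continuous (by fun_prop) (fun _ => mem_Ici.2 (le_max_right _ _))

theorem aux_gen_comm {T : ℝ → X →L[ℝ] X} (hT : IsC0Semigroup T) {G : X →ₗ.[ℝ] X}
    (hG : IsGeneratorOf G T) (u : G.domain) {s : ℝ} (hs : 0 ≤ s) :
    Tendsto (fun h : ℝ => h⁻¹ • (T (s + h) (u : X) - T s (u : X))) (𝓝[>] 0) (𝓝 (T s (G u))) := by
  have h1 := ((T s).continuous.tendsto _).comp (hG.2 u)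
  refine h1.congr' ?_
  filter_upwards [self_mem_nhdsWithin] with h hh
  simp only [Function.comp, map_smul, map_sub]
  rw [hT.map_add s h hs (le_of_lt hh)]
  rfl

theorem aux_gen_inv {T : ℝ → X →L[ℝ] X} (hT : IsC0Semigroup T) {G : X →ₗ.[ℝ] X}
    (hG : IsGeneratorOf G T) (u : G.domain) {s : ℝ} (hs : 0 ≤ s) :
    ∃ h : T s (u : X) ∈ G.domain, G ⟨T s (u : X), h⟩ = T s (G u) := by
  have h1 : Tendsto (fun h : ℝ => h⁻¹ • (T h (T s (u : X)) - T s (u : X))) (𝓝[>] 0)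
      (𝓝 (T s (G u))) := by
    refine (aux_gen_comm hT hG u hs).congr' ?_
    filter_upwards [self_mem_nhdsWithin] with h hh
    rw [add_comm, hT.map_add h s (le_of_lt hh) hs]
    rfl
  have h2 := (hG.1 _).2 ⟨_, h1⟩
  exact ⟨h2, tendsto_nhds_unique (hG.2 ⟨_, h2⟩) h1⟩

theorem aux_gen_deriv {T : ℝ → X →L[ℝ] X} (hT : IsC0Semigroup T) {G : X →ₗ.[ℝ] X}
    (hG : IsGeneratorOf G T) (u : G.domain) {s : ℝ} (hs : 0 ≤ s) :
    HasDerivWithinAt (fun t => T (max t 0) (u : X)) (T s (G u)) (Ioi s) s := by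
  rw [hasDerivWithinAt_iff_tendsto_slope' (by simp)]
  have h0 : Tendsto (fun t : ℝ => t - s) (𝓝[>] s) (𝓝[>] 0) := by
    apply tendsto_nhdsWithin_of_tendsto_nhds_of_eventually_within
    · have : Tendsto (fun t : ℝ => t - s) (𝓝 s) (𝓝 (s - s)) :=
        (continuous_id.sub continuous_const).tendsto s
      rw [sub_self] at this
      exact this.mono_left nhdsWithin_le_nhds
    · filter_upwards [self_mem_nhdsWithin] with t ht
      simpa using ht
  refine ((aux_gen_comm hT hG u hs).comp h0).congr' ?_
  filter_upwards [self_mem_nhdsWithin] with t ht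
  have ht' : s < t := ht
  simp only [Function.comp, slope, vsub_eq_sub]
  rw [max_eq_left hs, max_eq_left (hs.trans ht'.le)]
  simp

theorem aux_gen_ftc {T : ℝ → X →L[ℝ] X} (hT : IsC0Semigroup T) {G : X →ₗ.[ℝ] X}
    (hG : IsGeneratorOf G T) (u : G.domain) (l : ℝ) {t : ℝ} (ht : 0 ≤ t) :
    auxZ l (fun s => T (max s 0)) t (G u - l • (u : X)) =
      Real.exp (-l * t) • T t (u : X) - (u : X) := by
  have hc : ∀ v : X, Continuous fun s => T (max s 0) v := fun v => aux_clamp (hT.strongCont v)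
  have := intervalIntegral.integral_eq_sub_of_hasDeriv_right_of_le
    (f := fun s => Real.exp (-l * s) • T (max s 0) (u : X))
    (f' := fun s => Real.exp (-l * s) • T (max s 0) (G u - l • (u : X))) ht
    (Continuous.continuousOn (Continuous.smul (by fun_prop) (hc _))) ?_
    (Continuous.intervalIntegrable (Continuous.smul (by fun_prop) (hc _)) _ _)
  · unfold auxZ
    rw [this]
    simp [max_eq_left ht, hT.map_zero]
  · intro s hs
    have h1 : HasDerivWithinAt (fun s : ℝ => Real.exp (-l * s)) (Real.exp (-l * s) * (-l * 1))
      (Ioi s) s := (((hasDerivAt_id s).const_mul (-l)).exp).hasDerivWithinAt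
    have h2 := h1.smul (aux_gen_deriv hT hG u hs.1.le)
    refine h2.congr_deriv ?_
    simp only [max_eq_left hs.1.le, map_sub, map_smul, smul_sub, smul_smul]
    rw [sub_eq_add_neg, ← neg_smul]
    congr 2
    ring

theorem aux_gen_closed {T : ℝ → X →L[ℝ] X} (hT : IsC0Semigroup T) {G : X →ₗ.[ℝ] X}
    (hG : IsGeneratorOf G T) (w : ℕ → G.domain) (x y : X)
    (hx : Tendsto (fun k => ((w k : G.domain) : X)) atTop (𝓝 x))
    (hy : Tendsto (fun k => G (w k)) atTop (𝓝 y)) :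
    ∃ h : x ∈ G.domain, G ⟨x, h⟩ = y := by
  have hc : ∀ v : X, Continuous fun s => T (max s 0) v := fun v => aux_clamp (hT.strongCont v)
  have key : ∀ t, 0 ≤ t → ∫ s in (0:ℝ)..t, T (max s 0) y = T t x - x := by
    intro t ht
    have h1 := ((auxZ_cont 0 hc t).tendsto y).comp hy
    have h2 : Tendsto (fun k => T t ((w k : G.domain) : X) - ((w k : G.domain) : X)) atTop
      (𝓝 (T t x - x)) := (((T t).continuous.tendsto x).comp hx).sub hx
    have h3 := tendsto_nhds_unique h1 (h2.congr fun k => by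
      have := aux_gen_ftc hT hG (w k) 0 ht
      simp only [zero_smul, sub_zero, neg_zero, zero_mul, Real.exp_zero, one_smul] at this
      exact this.symm)
    simpa [auxZ] using h3
  have hd : HasDerivAt (fun t => ∫ s in (0:ℝ)..t, T (max s 0) y) (T (max 0 0) y) 0 :=
    intervalIntegral.integral_hasDerivAt_right (by simp)
      ((hc y).stronglyMeasurable.stronglyMeasurableAtFilter) ((hc y).continuousAt)
  have hd' := (hd.hasDerivWithinAt (s := Ioi 0))
  rw [hasDerivWithinAt_iff_tendsto_slope' (by simp)] at hd'
  have h1 : Tendsto (fun h : ℝ => h⁻¹ • (T h x - x)) (𝓝[>] 0) (𝓝 y) := by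
    simp only [max_self, hT.map_zero, ContinuousLinearMap.id_apply] at hd'
    refine hd'.congr' ?_
    filter_upwards [self_mem_nhdsWithin] with h hh
    simp only [slope, vsub_eq_sub, intervalIntegral.integral_same, sub_zero]
    rw [key h (le_of_lt hh)]
  have h2 := (hG.1 _).2 ⟨_, h1⟩
  exact ⟨h2, tendsto_nhds_unique (hG.2 ⟨_, h2⟩) h1⟩

theorem aux_resolvent {T : ℝ → X →L[ℝ] X} (hT : IsC0Semigroup T) {G : X →ₗ.[ℝ] X}
    (hG : IsGeneratorOf G T) {M : ℝ} (hM : ∀ t, 0 ≤ t → ‖T t‖ ≤ M) {l : ℝ} (hl : 0 < l) :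
    ∃ R : X →L[ℝ] X,
      (∀ u, Tendsto (fun t => auxZ l (fun s => T (max s 0)) t u) atTop (𝓝 (R u))) ∧
      (∀ u, ∃ h : R u ∈ G.domain, G ⟨R u, h⟩ = l • R u - u) ∧
      (∀ u : G.domain, R (l • (u : X) - G u) = u) ∧
      (∀ h, 0 ≤ h → ∀ u, T h (R u) = R (T h u)) ∧
      (∀ h, 0 ≤ h → ∀ u, auxZ l (fun s => T (max s 0)) h u =
        R (u - Real.exp (-l * h) • T h u)) ∧
      DenseRange R := by
  have hc : ∀ v : X, Continuous fun s => T (max s 0) v := fun v => aux_clamp (hT.strongCont v)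
  have hc' : ∀ v : X, Continuous fun s => Real.exp (-l * s) • T (max s 0) v := fun v =>
    Continuous.smul (by fun_prop) (hc v)
  have hbd : ∀ u s, ‖Real.exp (-l * s) • T (max s 0) u‖ ≤ Real.exp (-l * s) * (M * ‖u‖) := by
    intro u s
    rw [norm_smul, Real.norm_of_nonneg (Real.exp_nonneg _)]
    gcongr
    exact (T _).le_of_opNorm_le (hM _ (le_max_right _ _)) _
  have hei : IntegrableOn (fun s : ℝ => Real.exp (-l * s)) (Ioi 0) :=
    integrableOn_exp_mul_Ioi (by linarith) 0
  have hint : ∀ u, IntegrableOn (fun s => Real.exp (-l * s) • T (max s 0) u) (Ioi 0) := by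
    intro u
    refine Integrable.mono' (hei.mul_const (M * ‖u‖)) (hc' u).aestronglyMeasurable ?_
    exact Eventually.of_forall (hbd u)
  let R0 : X →ₗ[ℝ] X :=
    { toFun := fun u => ∫ s in Ioi (0:ℝ), Real.exp (-l * s) • T (max s 0) u
      map_add' := by
        intro u v
        simp only [map_add, smul_add]
        exact integral_add (hint u) (hint v)
      map_smul' := by
        intro c u
        simp only [map_smul, RingHom.id_apply]
        rw [← integral_smul]
        simp only [smul_comm c] }
  let R : X →L[ℝ] X := R0.mkContinuous ((∫ s in Ioi (0:ℝ), Real.exp (-l * s)) * M) (by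
    intro u
    refine (norm_integral_le_of_norm_le (hei.mul_const (M * ‖u‖))
      (Eventually.of_forall (hbd u))).trans ?_
    rw [integral_mul_const, mul_assoc])
  have hlim : ∀ u, Tendsto (fun t => auxZ l (fun s => T (max s 0)) t u) atTop (𝓝 (R u)) :=
    fun u => intervalIntegral_tendsto_integral_Ioi 0 (hint u) tendsto_id
  have hTR : ∀ h, 0 ≤ h → ∀ u, T h (R u) =
      Real.exp (l * h) • (R u - auxZ l (fun s => T (max s 0)) h u) := by
    intro h hh u
    have h1 := ((T h).continuous.tendsto _).comp (hlim u)
    have h2 : Tendsto (fun t => Real.exp (l * h) • (auxZ l (fun s => T (max s 0)) (t + h) u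
        - auxZ l (fun s => T (max s 0)) h u)) atTop
        (𝓝 (Real.exp (l * h) • (R u - auxZ l (fun s => T (max s 0)) h u))) :=
      (((hlim u).comp (tendsto_atTop_add_const_right _ h tendsto_id)).sub_const _).const_smul _
    refine tendsto_nhds_unique h1 (h2.congr' ?_)
    filter_upwards [eventually_ge_atTop 0] with t ht
    simp only [Function.comp, auxZ]
    rw [← ContinuousLinearMap.intervalIntegral_comp_comm _ ((hc' u).intervalIntegrable _ _),
      intervalIntegral.integral_interval_sub_left ((hc' u).intervalIntegrable _ _)
       ((hc' u).intervalIntegrable _ _)]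
    have := intervalIntegral.integral_comp_add_right
      (f := fun s => Real.exp (-l * s) • T (max s 0) u) (a := 0) (b := t) h
    rw [zero_add] at this
    rw [← this, ← intervalIntegral.integral_smul]
    apply intervalIntegral.integral_congr
    intro s hs
    rw [uIcc_of_le ht] at hs
    simp only [map_smul, smul_smul]
    rw [max_eq_left hs.1, max_eq_left (add_nonneg hs.1 hh), add_comm s h,
      hT.map_add h s hh hs.1, ← Real.exp_add]
    simp only [ContinuousLinearMap.comp_apply]
    congr 2
    ring
  have hdom : ∀ u, ∃ h : R u ∈ G.domain, G ⟨R u, h⟩ = l • R u - u := by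
    intro u
    have hd : HasDerivAt (fun t => auxZ l (fun s => T (max s 0)) t u)
        (Real.exp (-l * 0) • T (max 0 0) u) 0 :=
      intervalIntegral.integral_hasDerivAt_right (by simp)
        ((hc' u).stronglyMeasurable.stronglyMeasurableAtFilter) ((hc' u).continuousAt)
    have he : HasDerivAt (fun s : ℝ => Real.exp (l * s)) (Real.exp (l * 0) * (l * 1)) 0 :=
      ((hasDerivAt_id (0:ℝ)).const_mul l).exp
    have hd' := (he.smul (hd.const_sub (R u))).hasDerivWithinAt (s := Ioi 0)
    rw [hasDerivWithinAt_iff_tendsto_slope' (by simp)] at hd'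
    have h1 : Tendsto (fun h : ℝ => h⁻¹ • (T h (R u) - R u)) (𝓝[>] 0) (𝓝 (l • R u - u)) := by
      have e : Real.exp (l * 0) • -(Real.exp (-l * 0) • T (max 0 0) u) +
          (Real.exp (l * 0) * (l * 1)) • (R u - auxZ l (fun s => T (max s 0)) 0 u)
          = l • R u - u := by
        simp [auxZ, hT.map_zero]
        abel
      rw [← e]
      refine hd'.congr' ?_
      filter_upwards [self_mem_nhdsWithin] with h hh
      rw [hTR h (le_of_lt hh)]
      simp [slope, auxZ]
    have h2 := (hG.1 _).2 ⟨_, h1⟩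
    exact ⟨h2, tendsto_nhds_unique (hG.2 ⟨_, h2⟩) h1⟩
  have hinv : ∀ u : G.domain, R (l • (u : X) - G u) = u := by
    intro u
    have h1 : Tendsto (fun t => Real.exp (-l * t) • T t (u : X) - (u : X)) atTop
        (𝓝 (0 - (u : X))) := by
      refine Tendsto.sub_const ?_ _
      have h0 : Tendsto (fun t : ℝ => Real.exp (-l * t) * (M * ‖(u : X)‖)) atTop (𝓝 0) := by
        rw [← zero_mul (M * ‖(u : X)‖)]
        refine Tendsto.mul_const _ (Real.tendsto_exp_atBot.comp ?_)
        exact tendsto_id.const_mul_atTop_of_neg (by linarith)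
      refine squeeze_zero_norm' ?_ h0
      filter_upwards [eventually_ge_atTop 0] with t ht
      have := hbd u t
      rwa [max_eq_left ht] at this
    have h2 := tendsto_nhds_unique (hlim (G u - l • (u : X))) (h1.congr' (by
      filter_upwards [eventually_ge_atTop 0] with t ht
      exact (aux_gen_ftc hT hG u l ht).symm))
    rw [← neg_sub, map_neg, h2]
    simp
  have hcomm : ∀ h, 0 ≤ h → ∀ u, T h (R u) = R (T h u) := by
    intro h hh u
    obtain ⟨d, hd⟩ := hdom u
    obtain ⟨d2, hd2⟩ := aux_gen_inv hT hG ⟨R u, d⟩ hh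
    have := hinv ⟨_, d2⟩
    rw [hd2, hd] at this
    simp only [map_sub, map_smul, sub_sub_cancel] at this
    exact this.symm
  have hZ : ∀ h, 0 ≤ h → ∀ u, auxZ l (fun s => T (max s 0)) h u =
        R (u - Real.exp (-l * h) • T h u) := by
    intro h hh u
    rw [map_sub, map_smul, ← hcomm h hh, hTR h hh, smul_smul, ← Real.exp_add]
    simp
  refine ⟨R, hlim, hdom, hinv, hcomm, hZ, ?_⟩
  intro u
  have hd : HasDerivAt (fun t => auxZ l (fun s => T (max s 0)) t u)
      (Real.exp (-l * 0) • T (max 0 0) u) 0 :=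
    intervalIntegral.integral_hasDerivAt_right (by simp)
      ((hc' u).stronglyMeasurable.stronglyMeasurableAtFilter) ((hc' u).continuousAt)
  have hd' := hd.hasDerivWithinAt (s := Ioi 0)
  rw [hasDerivWithinAt_iff_tendsto_slope' (by simp)] at hd'
  simp only [mul_zero, Real.exp_zero, one_smul, max_self, hT.map_zero,
    ContinuousLinearMap.id_apply] at hd'
  refine mem_closure_of_tendsto hd' ?_
  filter_upwards [self_mem_nhdsWithin] with h hh
  refine ⟨h⁻¹ • (u - Real.exp (-l * h) • T h u), ?_⟩
  rw [map_smul, ← hZ h (le_of_lt hh)]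
  simp [slope, auxZ]

def auxC (l : ℝ) (F : ℕ → ℝ → X →L[ℝ] X) (J : X →L[ℝ] X) : ℕ → ℝ → X →L[ℝ] X
  | 0, t => ContinuousLinearMap.id ℝ X - Real.exp (-l * t) • F 0 t
  | n + 1, t => J.comp (auxC l F J n t) - Real.exp (-l * t) • F (n + 1) t

def auxD (l : ℝ) (F : ℕ → ℝ → X →L[ℝ] X) (J : X →L[ℝ] X) : ℕ → ℝ → X →L[ℝ] X
  | 0, t => Real.exp (-l * t) • F 0 t
  | n + 1, t => J.comp (auxD l F J n t) + Real.exp (-l * t) • F (n + 1) t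

theorem auxC_cont (l : ℝ) {F : ℕ → ℝ → X →L[ℝ] X} (J : X →L[ℝ] X)
    (hF : ∀ n u, Continuous fun t => F n t u) (n : ℕ) (u : X) :
    Continuous fun t => auxC l F J n t u := by
  induction n with
  | zero =>
    simp only [auxC, _root_.sub_apply, _root_.smul_apply]
    exact continuous_const.sub (Continuous.smul (by fun_prop) (hF 0 u))
  | succ n ih =>
    simp only [auxC, _root_.sub_apply, _root_.smul_apply,
      ContinuousLinearMap.comp_apply]
    exact (J.continuous.comp ih).sub (Continuous.smul (by fun_prop) (hF (n + 1) u))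

theorem auxC_D (l : ℝ) (F : ℕ → ℝ → X →L[ℝ] X) (J : X →L[ℝ] X) (n : ℕ) (t : ℝ) (u : X) :
    auxC l F J n t u + auxD l F J n t u = J^[n] u := by
  induction n with
  | zero => simp [auxC, auxD]
  | succ n ih =>
    rw [Function.iterate_succ_apply', ← ih]
    simp [auxC, auxD]

theorem aux_conv (l : ℝ) {F : ℕ → ℝ → X →L[ℝ] X} {R J : X →L[ℝ] X}
    (hF : ∀ n u, Continuous fun t => F n t u)
    (hZ0 : ∀ t, 0 ≤ t → ∀ u, auxZ l (F 0) t u = R (u - Real.exp (-l * t) • F 0 t u))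
    (hcomm : ∀ t, 0 ≤ t → ∀ u, F 0 t (R u) = R (F 0 t u))
    (hrec : ∀ n t, 0 ≤ t → ∀ v, F (n + 1) t (R v) =
      ∫ s in (0:ℝ)..t, F n (t - s) (J (F 0 s v))) (n : ℕ) (t : ℝ) (ht : 0 ≤ t) (v : X) :
    ∫ s in (0:ℝ)..t, auxC l F J n (t - s) (Real.exp (-l * s) • J (F 0 s v)) =
      auxC l F J (n + 1) t (R v) := by
  have hg : Continuous fun s => J (F 0 s v) := J.continuous.comp (hF 0 v)
  have hg' : Continuous fun s => Real.exp (-l * s) • J (F 0 s v) :=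
    Continuous.smul (by fun_prop) hg
  have hFg : ∀ n, Continuous fun s => F n (t - s) (J (F 0 s v)) := fun n =>
    aux_cont (hF n) (by fun_prop) hg
  have hFg' : ∀ n, Continuous fun s => Real.exp (-l * t) • F n (t - s) (J (F 0 s v)) := fun n =>
    (hFg n).const_smul _
  have hFe : ∀ n, ∫ s in (0:ℝ)..t, Real.exp (-l * t) • F n (t - s) (J (F 0 s v)) =
      Real.exp (-l * t) • F (n + 1) t (R v) := by
    intro n
    rw [intervalIntegral.integral_smul, hrec n t ht]
  have hexp : ∀ (n : ℕ) (s : ℝ), Real.exp (-l * (t - s)) •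
      F n (t - s) (Real.exp (-l * s) • J (F 0 s v)) =
      Real.exp (-l * t) • F n (t - s) (J (F 0 s v)) := by
    intro n s
    rw [map_smul, smul_smul, ← Real.exp_add]
    congr 2
    ring
  induction n with
  | zero =>
    simp only [auxC, _root_.sub_apply, _root_.smul_apply,
      ContinuousLinearMap.comp_apply, ContinuousLinearMap.id_apply, hexp]
    rw [intervalIntegral.integral_sub (hg'.intervalIntegrable _ _)
      ((hFg' 0).intervalIntegrable _ _), hFe]
    congr 1
    rw [hcomm t ht, ← map_smul, ← map_sub, ← hZ0 t ht, auxZ,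
      ← ContinuousLinearMap.intervalIntegral_comp_comm]
    · simp only [map_smul]
    · exact Continuous.intervalIntegrable (Continuous.smul (by fun_prop) (hF 0 v)) _ _
  | succ n ih =>
    have hC : Continuous fun s => auxC l F J n (t - s) (Real.exp (-l * s) • J (F 0 s v)) :=
      aux_cont (auxC_cont l J hF n) (by fun_prop) hg'
    have hJC : Continuous fun s => J (auxC l F J n (t - s) (Real.exp (-l * s) • J (F 0 s v))) :=
      J.continuous.comp hC
    rw [auxC, _root_.sub_apply, _root_.smul_apply,
      ContinuousLinearMap.comp_apply, ← ih, ← hFe (n + 1),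
      ← ContinuousLinearMap.intervalIntegral_comp_comm _ (hC.intervalIntegrable _ _),
      ← intervalIntegral.integral_sub (hJC.intervalIntegrable _ _)
      ((hFg' (n + 1)).intervalIntegrable _ _)]
    apply intervalIntegral.integral_congr
    intro s _
    simp only [← hexp]
    simp only [auxC, _root_.sub_apply, _root_.smul_apply,
      ContinuousLinearMap.comp_apply]

theorem aux_ZC (l : ℝ) {F : ℕ → ℝ → X →L[ℝ] X} {R J : X →L[ℝ] X}
    (hF : ∀ n u, Continuous fun t => F n t u)
    (hZ0 : ∀ t, 0 ≤ t → ∀ u, auxZ l (F 0) t u = R (u - Real.exp (-l * t) • F 0 t u))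
    (hcomm : ∀ t, 0 ≤ t → ∀ u, F 0 t (R u) = R (F 0 t u))
    (hrec : ∀ n t, 0 ≤ t → ∀ v, F (n + 1) t (R v) =
      ∫ s in (0:ℝ)..t, F n (t - s) (J (F 0 s v))) (hR : DenseRange R) (n : ℕ) :
    ∀ (t : ℝ) (_ : 0 ≤ t) (u : X), auxZ l (F n) t u = R (auxC l F J n t u) := by
  induction n with
  | zero =>
    intro t ht u
    rw [hZ0 t ht]
    simp [auxC]
  | succ n ih =>
    intro t ht u
    refine congrFun (DenseRange.equalizer hR (g := auxZ l (F (n + 1)) t)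
      (h := fun u => R (auxC l F J (n + 1) t u)) (auxZ_cont l (hF _) t) (by fun_prop) ?_) u
    funext v
    simp only [Function.comp]
    have hg : Continuous fun s => J (F 0 s v) := J.continuous.comp (hF 0 v)
    have hg' : Continuous fun s => Real.exp (-l * s) • J (F 0 s v) :=
      Continuous.smul (by fun_prop) hg
    have hC : Continuous fun s => auxC l F J n (t - s) (Real.exp (-l * s) • J (F 0 s v)) :=
      aux_cont (auxC_cont l J hF n) (by fun_prop) hg'
    rw [← aux_conv l hF hZ0 hcomm hrec n t ht v,
      ← ContinuousLinearMap.intervalIntegral_comp_comm _ (hC.intervalIntegrable _ _)]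
    have e1 : auxZ l (F (n + 1)) t (R v) =
        ∫ τ in (0:ℝ)..t, ∫ s in (0:ℝ)..τ, Real.exp (-l * τ) • F n (τ - s) (J (F 0 s v)) := by
      apply intervalIntegral.integral_congr
      intro τ hτ
      rw [uIcc_of_le ht] at hτ
      simp only
      rw [hrec n τ hτ.1, intervalIntegral.integral_smul]
    rw [e1, aux_triangle _ ht]
    · apply intervalIntegral.integral_congr
      intro s hs
      rw [uIcc_of_le ht] at hs
      simp only
      rw [← ih (t - s) (by linarith [hs.2])]
      have := intervalIntegral.integral_comp_sub_right
        (f := fun r => Real.exp (-l * r) • F n r (Real.exp (-l * s) • J (F 0 s v)))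
        (a := s) (b := t) s
      rw [sub_self] at this
      rw [auxZ, ← this]
      apply intervalIntegral.integral_congr
      intro τ _
      simp only [map_smul, smul_smul]
      rw [← Real.exp_add]
      congr 2
      ring
    · have := aux_cont (Y := ℝ × ℝ) (hF n) (a := fun p => p.1 - p.2) (by fun_prop)
        (hg.comp continuous_snd)
      exact Continuous.smul (f := fun p : ℝ × ℝ => Real.exp (-l * p.1)) (by fun_prop) this

theorem aux_sum_bound (l : ℝ) {F : ℕ → ℝ → X →L[ℝ] X} {R J : X →L[ℝ] X}
    (hF : ∀ n u, Continuous fun t => F n t u)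
    {K : Set X} (hKc : IsClosed K)
    (hKadd : ∀ u ∈ K, ∀ v ∈ K, u + v ∈ K) (hKsmul : ∀ c : ℝ, 0 ≤ c → ∀ u ∈ K, c • u ∈ K)
    (Ψ : X →L[ℝ] ℝ) (hΨ : ∀ u ∈ K, Ψ u = ‖u‖)
    (hFK : ∀ n t, ∀ u ∈ K, F n t u ∈ K)
    (hRJ : ∀ x, R x ∈ K → J x ∈ K ∧ Ψ (J x) ≤ Ψ x)
    (hZC : ∀ (n : ℕ) (t : ℝ) (_ : 0 ≤ t) (u : X), auxZ l (F n) t u = R (auxC l F J n t u))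
    {t : ℝ} (ht : 0 < t) {u : X} (hu : u ∈ K) (n : ℕ) :
    Real.exp (-l * t) * ∑ k ∈ Finset.range (n + 1), ‖F k t u‖ ≤ ‖u‖ := by
  have hm : ∀ n, J (auxC l F J n t u) ∈ K ∧ Ψ (J (auxC l F J n t u)) ≤ Ψ (auxC l F J n t u) := by
    intro n
    apply hRJ
    rw [← hZC n t ht.le u]
    exact aux_cone_integral hKc hKadd hKsmul (Continuous.smul (by fun_prop) (hF n u)) ht
      (fun s _ => hKsmul _ (Real.exp_nonneg _) _ (hFK n s u hu))
  have key : Ψ (J (auxC l F J n t u)) +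
      Real.exp (-l * t) * ∑ k ∈ Finset.range (n + 1), ‖F k t u‖ ≤ ‖u‖ := by
    induction n with
    | zero =>
      have h1 := (hm 0).2
      have h2 : Ψ (auxC l F J 0 t u) = ‖u‖ - Real.exp (-l * t) * ‖F 0 t u‖ := by
        simp [auxC, hΨ u hu, hΨ _ (hFK 0 t u hu)]
      simp only [zero_add, Finset.range_one, Finset.sum_singleton]
      linarith
    | succ n ih =>
      have h1 := (hm (n + 1)).2
      have h2 : Ψ (auxC l F J (n + 1) t u) =
          Ψ (J (auxC l F J n t u)) - Real.exp (-l * t) * ‖F (n + 1) t u‖ := by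
        simp [auxC, hΨ _ (hFK (n + 1) t u hu)]
      rw [Finset.sum_range_succ, mul_add]
      linarith
  have h0 := hΨ _ (hm n).1
  have := norm_nonneg (J (auxC l F J n t u))
  linarith

theorem aux_D_bound (l : ℝ) {F : ℕ → ℝ → X →L[ℝ] X} {J : X →L[ℝ] X}
    {K : Set X}
    (hKadd : ∀ u ∈ K, ∀ v ∈ K, u + v ∈ K) (hKsmul : ∀ c : ℝ, 0 ≤ c → ∀ u ∈ K, c • u ∈ K)
    (hFK : ∀ n t, ∀ u ∈ K, F n t u ∈ K)
    (hJ : ∀ x ∈ K, J x ∈ K ∧ ‖J x‖ ≤ ‖x‖)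
    {t : ℝ} {u : X} (hu : u ∈ K) (n : ℕ) :
    auxD l F J n t u ∈ K ∧
    ‖auxD l F J n t u‖ ≤ Real.exp (-l * t) * ∑ k ∈ Finset.range (n + 1), ‖F k t u‖ := by
  have hn : ∀ k, ‖Real.exp (-l * t) • F k t u‖ = Real.exp (-l * t) * ‖F k t u‖ := fun k => by
    rw [norm_smul, Real.norm_of_nonneg (Real.exp_nonneg _)]
  induction n with
  | zero =>
    refine ⟨hKsmul _ (Real.exp_nonneg _) _ (hFK 0 t u hu), ?_⟩
    simp only [auxD, _root_.smul_apply, hn]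
    simp
  | succ n ih =>
    refine ⟨hKadd _ (hJ _ ih.1).1 _ (hKsmul _ (Real.exp_nonneg _) _ (hFK _ t u hu)), ?_⟩
    rw [Finset.sum_range_succ, mul_add]
    simp only [auxD, _root_.add_apply, ContinuousLinearMap.comp_apply,
      _root_.smul_apply]
    refine (norm_add_le _ _).trans (add_le_add ((hJ _ ih.1).2.trans ih.2) (hn _).le)

theorem aux_conv_deriv {h : ℝ → ℝ → X} (hh : Continuous h.uncurry) :
    Tendsto (fun t : ℝ => t⁻¹ • ∫ s in (0:ℝ)..t, h t s) (𝓝[>] 0) (𝓝 (h 0 0)) := by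
  rw [Metric.tendsto_nhds]
  intro ε hε
  obtain ⟨δ, hδ, H⟩ := Metric.continuousAt_iff.1 (hh.continuousAt (x := (0, 0))) (ε / 2)
    (by positivity)
  filter_upwards [Ioo_mem_nhdsGT hδ] with t ht
  have hc : Continuous fun s => h t s := hh.comp (continuous_const.prodMk continuous_id)
  have h1 : ‖∫ s in (0:ℝ)..t, (h t s - h 0 0)‖ ≤ ε / 2 * |t - 0| := by
    apply intervalIntegral.norm_integral_le_of_norm_le_const
    intro s hs
    rw [uIoc_of_le ht.1.le] at hs
    have := @H (t, s) (by
      rw [Prod.dist_eq, max_lt_iff]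
      simp only [Real.dist_eq, sub_zero]
      rw [abs_of_pos ht.1, abs_of_pos hs.1]
      exact ⟨ht.2, hs.2.trans_lt ht.2⟩)
    rw [dist_eq_norm] at this
    exact this.le
  rw [intervalIntegral.integral_sub (hc.intervalIntegrable _ _) (by simp),
    intervalIntegral.integral_const, sub_zero, abs_of_pos ht.1] at h1
  have h2 : t⁻¹ • (∫ s in (0:ℝ)..t, h t s) - h 0 0 =
      t⁻¹ • ((∫ s in (0:ℝ)..t, h t s) - t • h 0 0) := by
    rw [smul_sub, smul_smul, inv_mul_cancel₀ ht.1.ne', one_smul]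
  rw [dist_eq_norm, h2, norm_smul, norm_inv, Real.norm_of_nonneg ht.1.le]
  calc t⁻¹ * _ ≤ t⁻¹ * (ε / 2 * t) := by
        have := ht.1
        gcongr
    _ = ε / 2 := by have := ht.1.ne'; field_simp
    _ < ε := by linarith

/-- `lim_{t→∞} supₙ ‖B ∫ₜ^∞ e^{-λs} Vₙ(s)u ds‖ = 0`: the tails of the Laplace-transform
integrals of the Dyson–Phillips iterates vanish uniformly in `n`. Here `Wt n u λ t` denotes
the tail integral `∫ₜ^∞ e^{-λs} Vₙ(s)u ds`, which lies in `D(A)`. -/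
theorem tail_laplace_uniformly_small
    (hconeadd : ∀ u v : X, 0 ≤ u → 0 ≤ v → 0 ≤ u + v)
    (hconesmul : ∀ (c : ℝ) (u : X), 0 ≤ c → 0 ≤ u → 0 ≤ c • u)
    (hgen : ∀ u : X, ∃ v w : X, 0 ≤ v ∧ 0 ≤ w ∧ u = v - w)
    (haddnorm : ∀ u v : X, 0 ≤ u → 0 ≤ v → ‖u + v‖ = ‖u‖ + ‖v‖)
    (Ψ : X →L[ℝ] ℝ) (hΨ : ∀ u : X, 0 ≤ u → Ψ u = ‖u‖)
    (U : ℝ → X →L[ℝ] X) (hU : IsSubstochastic U)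
    (A : X →ₗ.[ℝ] X) (hA : IsGeneratorOf A U)
    (B : A.domain →ₗ[ℝ] X)
    (hBpos : ∀ u : A.domain, 0 ≤ (u : X) → 0 ≤ B u)
    (hdiss : ∀ u : A.domain, 0 ≤ (u : X) → Ψ (A u + B u) ≤ 0)
    -- the minimal substochastic semigroup V generated by an extension G of A + B
    (G : X →ₗ.[ℝ] X) (V : ℝ → X →L[ℝ] X)
    (hV : IsSubstochastic V) (hGV : IsGeneratorOf G V)
    (hGext : ∀ u : A.domain, ∃ h : (u : X) ∈ G.domain, G ⟨(u : X), h⟩ = A u + B u)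
    -- U leaves D(A) invariant
    (hUdom : ∀ (s : ℝ), 0 ≤ s → ∀ u : A.domain, U s (u : X) ∈ A.domain)
    -- the Dyson-Phillips iterates: V₀ = U, V_{n+1}(t)u = ∫₀ᵗ Vₙ(t-s) B U(s)u ds on D(A),
    -- each extended to a bounded positive operator on X
    (Vn : ℕ → ℝ → X →L[ℝ] X)
    (hVnpos : ∀ (n : ℕ) (t : ℝ), 0 ≤ t → ∀ u : X, 0 ≤ u → 0 ≤ Vn n t u)
    (hVncont : ∀ (n : ℕ) (u : X), ContinuousOn (fun t => Vn n t u) (Ici (0 : ℝ)))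
    (hV0 : Vn 0 = U)
    (hVrec : ∀ (n : ℕ) (t : ℝ), 0 ≤ t → ∀ u : A.domain,
      Vn (n + 1) t (u : X) =
        ∫ s in (0:ℝ)..t,
          Vn n (t - s) (B ⟨U (max s 0) (u : X), hUdom (max s 0) (le_max_right _ _) u⟩))
    -- the tail integrals ∫ₜ^∞ e^{-λs} Vₙ(s)u ds, which belong to D(A)
    (Wt : ℕ → X → ℝ → ℝ → X)
    (hWtdom : ∀ (n : ℕ) (u : X) (l t : ℝ), Wt n u l t ∈ A.domain)
    (hWt : ∀ (n : ℕ) (u : X) (l : ℝ), 0 < l → ∀ t : ℝ, 0 ≤ t →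
      Tendsto (fun T : ℝ => ∫ s in t..T, Real.exp (-l * s) • Vn n s u) atTop
        (𝓝 (Wt n u l t))) :
    ∀ (l : ℝ), 0 < l → ∀ u : X, ∀ ε : ℝ, 0 < ε → ∃ T : ℝ, 0 ≤ T ∧
      ∀ t : ℝ, T ≤ t → ∀ n : ℕ, ‖B ⟨Wt n u l t, hWtdom n u l t⟩‖ < ε := by
  set K : Set X := closure {u : X | 0 ≤ u} with hK
  have hKc : IsClosed K := isClosed_closure
  have hsub : ∀ u : X, 0 ≤ u → u ∈ K := fun u hu => subset_closure hu
  have hKadd : ∀ u ∈ K, ∀ v ∈ K, u + v ∈ K := fun u hu v hv =>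
    map_mem_closure₂ continuous_add hu hv (fun a ha b hb => hconeadd a b ha hb)
  have hKsmul : ∀ c : ℝ, 0 ≤ c → ∀ u ∈ K, c • u ∈ K := fun c hc u hu =>
    map_mem_closure (continuous_const_smul c) hu (fun a ha => hconesmul c a hc ha)
  have hΨK : ∀ u ∈ K, Ψ u = ‖u‖ := fun u hu =>
    closure_minimal (t := {u : X | Ψ u = ‖u‖}) (fun v hv => hΨ v hv)
      (isClosed_eq Ψ.continuous continuous_norm) hu
  have hVK : ∀ t, 0 ≤ t → ∀ u ∈ K, V t u ∈ K := fun t ht u hu =>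
    map_mem_closure (V t).continuous hu (fun a ha => (hV.2 t ht a ha).1)
  have hVn' : ∀ t, 0 ≤ t → ∀ u ∈ K, ‖V t u‖ ≤ ‖u‖ := fun t ht u hu =>
    closure_minimal (t := {u : X | ‖V t u‖ ≤ ‖u‖}) (fun v hv => (hV.2 t ht v hv).2)
      (isClosed_le (V t).continuous.norm continuous_norm) hu
  have hΨG : ∀ w : G.domain, (w : X) ∈ K → Ψ (G w) ≤ 0 := by
    intro w hw
    refine le_of_tendsto ((Ψ.continuous.tendsto _).comp (hGV.2 w)) ?_
    filter_upwards [self_mem_nhdsWithin] with h hh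
    have hh' : (0:ℝ) < h := hh
    simp only [Function.comp, map_smul, map_sub, smul_eq_mul]
    rw [hΨK _ hw, hΨK _ (hVK h hh'.le _ hw)]
    have := hVn' h hh'.le _ hw
    exact mul_nonpos_of_nonneg_of_nonpos (by positivity) (by linarith)
  obtain ⟨M, hM⟩ : ∃ M, ∀ t, 0 ≤ t → ‖U t‖ ≤ M := by
    obtain ⟨M, hM⟩ := banach_steinhaus (g := fun i : Ici (0:ℝ) => U i) (by
      intro x
      obtain ⟨v, w, hv, hw, rfl⟩ := hgen x
      refine ⟨‖v‖ + ‖w‖, fun i => ?_⟩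
      rw [map_sub]
      exact (norm_sub_le _ _).trans (add_le_add (hU.2 i i.2 v hv).2 (hU.2 i i.2 w hw).2))
    exact ⟨M, fun t ht => hM ⟨t, ht⟩⟩
  let F : ℕ → ℝ → X →L[ℝ] X := fun n t => Vn n (max t 0)
  have hF : ∀ n u, Continuous fun t => F n t u := fun n u => aux_clamp (hVncont n u)
  have hFK : ∀ n t, ∀ u ∈ K, F n t u ∈ K := fun n t u hu =>
    map_mem_closure (F n t).continuous hu (fun a ha => hVnpos n _ (le_max_right _ _) a ha)
  have hF0 : F 0 = fun s => U (max s 0) := by simp only [F, hV0]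
  have hF0t : ∀ t, 0 ≤ t → F 0 t = U t := fun t ht => by rw [hF0]; simp [max_eq_left ht]
  have hFt : ∀ n t, 0 ≤ t → F n t = Vn n t := fun n t ht => by simp [F, max_eq_left ht]
  have hmain : ∀ l : ℝ, 0 < l → ∃ R J : X →L[ℝ] X,
      (∀ x, ∃ h : R x ∈ A.domain, B ⟨R x, h⟩ = J x) ∧
      (∀ x, R x ∈ K → J x ∈ K ∧ Ψ (J x) ≤ Ψ x) ∧
      (∀ x ∈ K, R x ∈ K) ∧
      (∀ (n : ℕ) (t : ℝ) (_ : 0 ≤ t) (u : X), auxZ l (F n) t u = R (auxC l F J n t u)) := by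
    intro l hl
    obtain ⟨R, hlim, hdom, hinv, hcomm, hZ, hdense⟩ := aux_resolvent hU.1 hA hM hl
    have hRK : ∀ x ∈ K, R x ∈ K := by
      intro x hx
      refine hKc.mem_of_tendsto (hlim x) ?_
      filter_upwards [eventually_gt_atTop 0] with t ht
      rw [← hF0]
      exact aux_cone_integral hKc hKadd hKsmul (Continuous.smul (by fun_prop) (hF 0 x)) ht
        (fun s _ => hKsmul _ (Real.exp_nonneg _) _ (hFK 0 s x hx))
    have hd : ∀ x, R x ∈ A.domain := fun x => (hdom x).1
    have hAR : ∀ x, A ⟨R x, hd x⟩ = l • R x - x := fun x => (hdom x).2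
    let J0 : X →ₗ[ℝ] X :=
      { toFun := fun x => B ⟨R x, hd x⟩
        map_add' := by
          intro x y
          rw [← map_add]
          congr 1
          exact Subtype.ext (map_add R x y)
        map_smul' := by
          intro c x
          rw [RingHom.id_apply, ← map_smul]
          congr 1
          exact Subtype.ext (map_smul R c x) }
    have hJ0 : ∀ x, J0 x = B ⟨R x, hd x⟩ := fun x => rfl
    have hGd : ∀ x, R x ∈ G.domain := fun x => (hGext ⟨R x, hd x⟩).1
    have hGR : ∀ x, G ⟨R x, hGd x⟩ = (l • R x - x) + J0 x := fun x => by
      rw [hJ0, ← hAR]; exact (hGext ⟨R x, hd x⟩).2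
    have hJcont : Continuous J0 := by
      apply J0.continuous_of_seq_closed_graph
      intro a x y hax hay
      have h1 : Tendsto (fun k => R (a k)) atTop (𝓝 (R x)) := (R.continuous.tendsto x).comp hax
      have h2 : Tendsto (fun k => G ⟨R (a k), hGd (a k)⟩) atTop (𝓝 ((l • R x - x) + y)) := by
        simp only [hGR]
        exact ((h1.const_smul l).sub hax).add hay
      obtain ⟨h3, h4⟩ := aux_gen_closed hV.1 hGV (fun k => ⟨R (a k), hGd (a k)⟩) _ _ h1 h2
      have h5 := hGR x
      rw [h4] at h5
      exact add_left_cancel h5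
    let J : X →L[ℝ] X := ⟨J0, hJcont⟩
    have hJ : ∀ x, B ⟨R x, hd x⟩ = J x := fun x => rfl
    have hrec : ∀ n t, 0 ≤ t → ∀ v, F (n + 1) t (R v) =
        ∫ s in (0:ℝ)..t, F n (t - s) (J (F 0 s v)) := by
      intro n t ht v
      rw [hFt _ _ ht, hVrec n t ht ⟨R v, hd v⟩]
      apply intervalIntegral.integral_congr
      intro s hs
      rw [uIcc_of_le ht] at hs
      simp only
      rw [hFt n (t - s) (by linarith [hs.2]), ← hJ, hF0]
      congr 2
      exact Subtype.ext (hcomm _ (le_max_right _ _) v)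
    have hcomm' : ∀ t, 0 ≤ t → ∀ u, F 0 t (R u) = R (F 0 t u) := by
      intro t ht u
      rw [hF0t t ht]
      exact hcomm t ht u
    have hZ0 : ∀ t, 0 ≤ t → ∀ u,
        auxZ l (F 0) t u = R (u - Real.exp (-l * t) • F 0 t u) := by
      intro t ht u
      rw [hF0t t ht, hF0]
      exact hZ t ht u
    refine ⟨R, J, fun x => ⟨hd x, rfl⟩, ?_, hRK, aux_ZC l hF hZ0 hcomm' hrec hdense⟩
    intro x hx
    constructor
    · have hc : Continuous (Function.uncurry fun t s => F 0 (t - s) (J (F 0 s x))) :=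
        aux_cont (Y := ℝ × ℝ) (hF 0) (a := fun p => p.1 - p.2) (by fun_prop)
          ((J.continuous.comp (hF 0 x)).comp continuous_snd)
      have h1 := aux_conv_deriv hc
      have h2 : F 0 (0 - 0) (J (F 0 0 x)) = J x := by
        rw [sub_self, hF0t 0 le_rfl, hU.1.map_zero]; rfl
      rw [h2] at h1
      refine hKc.mem_of_tendsto h1 ?_
      filter_upwards [self_mem_nhdsWithin] with t ht
      have ht' : (0:ℝ) < t := ht
      rw [← hrec 0 t ht'.le]
      exact hKsmul _ (by positivity) _ (hFK _ _ _ hx)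
    · have h1 := hΨG ⟨R x, hGd x⟩ hx
      rw [hGR] at h1
      simp only [map_add, map_sub, map_smul, smul_eq_mul] at h1
      rw [hΨK _ hx] at h1
      have h2 : 0 ≤ l * ‖R x‖ := by positivity
      have h3 : Ψ (J x) = Ψ (J0 x) := rfl
      linarith
  have hsum : ∀ l : ℝ, 0 < l → ∀ t, 0 < t → ∀ u ∈ K, ∀ n : ℕ,
      Real.exp (-l * t) * ∑ k ∈ Finset.range (n + 1), ‖F k t u‖ ≤ ‖u‖ := by
    intro l hl t ht u hu n
    obtain ⟨R, J, -, hRJ, -, hZC⟩ := hmain l hl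
    exact aux_sum_bound l hF hKc hKadd hKsmul Ψ hΨK hFK hRJ hZC ht hu n
  intro l hl u ε hε
  have hsum2 : ∀ t, 0 < t → ∀ u ∈ K, ∀ n : ℕ,
      Real.exp (-l * t) * ∑ k ∈ Finset.range (n + 1), ‖F k t u‖ ≤
        Real.exp (-(l / 2) * t) * ‖u‖ := by
    intro t ht u hu n
    have h1 := hsum (l / 2) (by positivity) t ht u hu n
    have h2 : Real.exp (-l * t) = Real.exp (-(l / 2) * t) * Real.exp (-(l / 2) * t) := by
      rw [← Real.exp_add]; congr 1; ring
    rw [h2, mul_assoc]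
    gcongr
  obtain ⟨R, J, hRd, hRJ, hRK, hZC⟩ := hmain l hl
  have hJK : ∀ x ∈ K, J x ∈ K ∧ ‖J x‖ ≤ ‖x‖ := by
    intro x hx
    obtain ⟨h1, h2⟩ := hRJ x (hRK x hx)
    rw [hΨK _ h1, hΨK _ hx] at h2
    exact ⟨h1, h2⟩
  have hD : ∀ t, 0 < t → ∀ u ∈ K, ∀ n : ℕ, auxD l F J n t u ∈ K ∧
      ‖auxD l F J n t u‖ ≤ Real.exp (-(l / 2) * t) * ‖u‖ := by
    intro t ht u hu n
    obtain ⟨h1, h2⟩ := aux_D_bound l hKadd hKsmul hFK hJK (t := t) hu n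
    exact ⟨h1, h2.trans (hsum2 t ht u hu n)⟩
  obtain ⟨v, w, hv, hw, huvw⟩ := hgen u
  have hDu : ∀ t, 0 < t → ∀ n : ℕ, ‖auxD l F J n t u‖ ≤
      Real.exp (-(l / 2) * t) * (‖v‖ + ‖w‖) ∧
      ‖J (auxD l F J n t u)‖ ≤ Real.exp (-(l / 2) * t) * (‖v‖ + ‖w‖) := by
    intro t ht n
    obtain ⟨a1, a2⟩ := hD t ht v (hsub v hv) n
    obtain ⟨b1, b2⟩ := hD t ht w (hsub w hw) n
    rw [huvw, map_sub, map_sub, mul_add]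
    exact ⟨(norm_sub_le _ _).trans (add_le_add a2 b2),
      (norm_sub_le _ _).trans (add_le_add ((hJK _ a1).2.trans a2) ((hJK _ b1).2.trans b2))⟩
  have hdecay : Tendsto (fun t : ℝ => Real.exp (-(l / 2) * t) * (‖v‖ + ‖w‖)) atTop (𝓝 0) := by
    rw [← zero_mul (‖v‖ + ‖w‖)]
    refine Tendsto.mul_const _ (Real.tendsto_exp_atBot.comp ?_)
    exact tendsto_id.const_mul_atTop_of_neg (by linarith)
  have hDlim : ∀ n : ℕ, Tendsto (fun t => auxD l F J n t u) atTop (𝓝 0) := by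
    intro n
    refine squeeze_zero_norm' ?_ hdecay
    filter_upwards [eventually_gt_atTop 0] with t ht
    exact (hDu t ht n).1
  have hWeq : ∀ (n : ℕ) (t : ℝ), 0 ≤ t → Wt n u l t = R (auxD l F J n t u) := by
    intro n t ht
    have hci : Continuous fun s => Real.exp (-l * s) • F n s u :=
      Continuous.smul (by fun_prop) (hF n u)
    have h1 : Tendsto (fun T => R (auxD l F J n t u - auxD l F J n T u)) atTop
        (𝓝 (R (auxD l F J n t u - 0))) :=
      (R.continuous.tendsto _).comp ((hDlim n).const_sub _)
    rw [sub_zero] at h1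
    refine tendsto_nhds_unique (hWt n u l hl t ht) (h1.congr' ?_)
    filter_upwards [eventually_ge_atTop t] with T hT
    have h2 : ∫ s in t..T, Real.exp (-l * s) • Vn n s u =
        ∫ s in t..T, Real.exp (-l * s) • F n s u := by
      apply intervalIntegral.integral_congr
      intro s hs
      rw [uIcc_of_le hT] at hs
      simp only
      rw [hFt n s (ht.trans hs.1)]
    rw [h2, ← intervalIntegral.integral_interval_sub_left (a := 0) (hci.intervalIntegrable _ _)
      (hci.intervalIntegrable _ _)]
    have h3 := hZC n T (ht.trans hT) u
    have h4 := hZC n t ht u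
    unfold auxZ at h3 h4
    rw [h3, h4, ← map_sub]
    congr 1
    have h5 := auxC_D l F J n T u
    have h6 := auxC_D l F J n t u
    rw [← h6] at h5
    rw [sub_eq_sub_iff_add_eq_add, add_comm, h5.symm.trans (add_comm _ _)]
    abel
  obtain ⟨T, hT⟩ := ((hdecay.eventually (gt_mem_nhds hε)).and (eventually_gt_atTop 0)).exists_forall_of_atTop
  refine ⟨max T 0, le_max_right _ _, ?_⟩
  intro t ht n
  obtain ⟨h1, h2⟩ := hT t ((le_max_left _ _).trans ht)
  obtain ⟨d, hd⟩ := hRd (auxD l F J n t u)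
  have e : B ⟨Wt n u l t, hWtdom n u l t⟩ = J (auxD l F J n t u) := by
    rw [← hd]
    congr 1
    exact Subtype.ext (hWeq n t h2.le)
  rw [e]
  exact (hDu t h2 n).2.trans_lt h1
end
end
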